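/- Let f be an endomorphism of A₁. Then there exist involutions γ and δ on A₁, each conjugate to α, such that f ∘ γ = δ ∘ f, if and only if f is an automorphism of A₁. -/

import Mathlib

noncomputable section

/-- `f : A → A` is a `K`-algebra endomorphism (as a bare function). -/
def IsAlgEndo (K : Type) [CommSemiring K] {A : Type} [Semiring A] [Algebra K A]
    (f : A → A) : Prop :=
  (∀ a b : A, f (a + b) = f a + f b) ∧
  (∀ (c : K) (a : A), f (c • a) = c • f a) ∧
  (∀ a b : A, f (a * b) = f a * f b) ∧ f 1 = 1

/-- `f : A → A` is a `K`-algebra automorphism: a bijective endomorphism. -/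
def IsAlgAuto (K : Type) [CommSemiring K] {A : Type} [Semiring A] [Algebra K A]
    (f : A → A) : Prop :=
  IsAlgEndo K f ∧ Function.Bijective f

/-- `f : A → A` is a `K`-linear anti-endomorphism. -/
def IsAntiEndo (K : Type) [CommSemiring K] {A : Type} [Semiring A] [Algebra K A]
    (f : A → A) : Prop :=
  (∀ a b : A, f (a + b) = f a + f b) ∧
  (∀ (c : K) (a : A), f (c • a) = c • f a) ∧
  (∀ a b : A, f (a * b) = f b * f a) ∧ f 1 = 1

/-- `f : A → A` is an anti-automorphism: a bijective anti-endomorphism. -/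
def IsAntiAuto (K : Type) [CommSemiring K] {A : Type} [Semiring A] [Algebra K A]
    (f : A → A) : Prop :=
  IsAntiEndo K f ∧ Function.Bijective f

/-- An involution on a `K`-algebra: an anti-automorphism of order at most two. -/
def IsInvolutionOn (K : Type) [CommSemiring K] {A : Type} [Semiring A] [Algebra K A]
    (γ : A → A) : Prop :=
  IsAntiAuto K γ ∧ γ ∘ γ = id

/-- The defining relation of the first Weyl algebra: `Y*X = X*Y + 1`. -/
inductive WeylRel (K : Type) [CommSemiring K] :
    FreeAlgebra K (Fin 2) → FreeAlgebra K (Fin 2) → Prop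
  | rel : WeylRel K (FreeAlgebra.ι K 1 * FreeAlgebra.ι K 0)
      (FreeAlgebra.ι K 0 * FreeAlgebra.ι K 1 + 1)

/-- The first Weyl algebra `A₁(K) = K⟨X,Y⟩/(YX - XY - 1)`. -/
abbrev Weyl (K : Type) [CommSemiring K] : Type := RingQuot (WeylRel K)

/-- The generator `X` of the Weyl algebra. -/
def Wx (K : Type) [CommSemiring K] : Weyl K :=
  RingQuot.mkAlgHom K (WeylRel K) (FreeAlgebra.ι K 0)

/-- The generator `Y` of the Weyl algebra. -/
def Wy (K : Type) [CommSemiring K] : Weyl K :=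
  RingQuot.mkAlgHom K (WeylRel K) (FreeAlgebra.ι K 1)

/-- `α` is the exchange involution: the involution with `α X = Y` and `α Y = X`. -/
def IsExchange (K : Type) [CommSemiring K] (α : Weyl K → Weyl K) : Prop :=
  IsInvolutionOn K α ∧ α (Wx K) = Wy K ∧ α (Wy K) = Wx K

/-- `γ` is conjugate to `α` by an automorphism or an anti-automorphism:
`γ = g⁻¹ ∘ α ∘ g`. -/
def ConjToAlpha (K : Type) [CommSemiring K] (α γ : Weyl K → Weyl K) : Prop :=
  ∃ g : Weyl K → Weyl K, (IsAlgAuto K g ∨ IsAntiAuto K g) ∧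
    γ = Function.invFun g ∘ α ∘ g


section WeylBasics

def WA (R : Type) [CommRing R] : Type := Weyl R

instance instRingWA (R : Type) [CommRing R] : Ring (WA R) := inferInstanceAs (Ring (Weyl R))
instance instAlgWA (R : Type) [CommRing R] : Algebra R (WA R) := inferInstanceAs (Algebra R (Weyl R))

def wx (R : Type) [CommRing R] : WA R := Wx R
def wy (R : Type) [CommRing R] : WA R := Wy R

variable {R : Type} [CommRing R]

theorem W_rel : wy R * wx R = wx R * wy R + 1 := by
  have h := RingQuot.mkAlgHom_rel R (WeylRel.rel (K := R))
  rw [map_mul, map_add, map_mul, map_one] at h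
  exact h

theorem W_induction {C : WA R → Prop} (h0 : ∀ r, C (algebraMap R (WA R) r))
    (hx : C (wx R)) (hy : C (wy R)) (ha : ∀ a b, C a → C b → C (a + b))
    (hm : ∀ a b, C a → C b → C (a * b)) (w : WA R) : C w := by
  obtain ⟨v, rfl⟩ := RingQuot.mkAlgHom_surjective R (WeylRel R) w
  induction v using FreeAlgebra.induction with
  | grade0 r => rw [AlgHom.commutes]; exact h0 r
  | grade1 i =>
    fin_cases i
    · exact hx
    · exact hy
  | mul a b h1 h2 => rw [map_mul]; exact hm _ _ h1 h2
  | add a b h1 h2 => rw [map_add]; exact ha _ _ h1 h2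

def wlift0 {B : Type} [Ring B] [Algebra R B] (a b : B) (h : b * a = a * b + 1) :
    Weyl R →ₐ[R] B :=
  RingQuot.liftAlgHom R ⟨FreeAlgebra.lift R ![a, b], by
    intro x y hxy
    cases hxy
    simpa using h⟩

def wlift {B : Type} [Ring B] [Algebra R B] (a b : B) (h : b * a = a * b + 1) :
    WA R →ₐ[R] B :=
  wlift0 a b h

theorem wlift_x {B : Type} [Ring B] [Algebra R B] (a b : B) (h : b * a = a * b + 1) :
    wlift (R := R) a b h (wx R) = a := by
  have : wlift0 (R := R) a b h (Wx R) = a := by simp [wlift0, Wx]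
  exact this

theorem wlift_y {B : Type} [Ring B] [Algebra R B] (a b : B) (h : b * a = a * b + 1) :
    wlift (R := R) a b h (wy R) = b := by
  have : wlift0 (R := R) a b h (Wy R) = b := by simp [wlift0, Wy]
  exact this

theorem exists_wmap {S : Type} [CommRing S] (φ : R →+* S) :
    ∃ F : WA R →+* WA S, F (wx R) = wx S ∧ F (wy R) = wy S ∧
      ∀ (r : R) (w : WA R), F (r • w) = φ r • F w := by
  let _ : Algebra R (WA S) := ((algebraMap S (WA S)).comp φ).toAlgebra' (by
    intro c x
    exact Algebra.commutes (A := WA S) (φ c) x)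
  refine ⟨(wlift (R := R) (wx S) (wy S) W_rel).toRingHom, wlift_x _ _ _, wlift_y _ _ _, ?_⟩
  intro r w
  have := map_smul (wlift (R := R) (wx S) (wy S) W_rel) r w
  refine this.trans ?_
  rw [Algebra.smul_def, Algebra.smul_def]
  rfl

def opX (R : Type) [CommRing R] : (ℕ × ℕ →₀ R) →ₗ[R] (ℕ × ℕ →₀ R) :=
  Finsupp.linearCombination R (fun I => Finsupp.single (I.1 + 1, I.2) 1)

def opY (R : Type) [CommRing R] : (ℕ × ℕ →₀ R) →ₗ[R] (ℕ × ℕ →₀ R) :=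
  Finsupp.linearCombination R (fun I => Finsupp.single (I.1 - 1, I.2) (I.1 : R) +
    Finsupp.single (I.1, I.2 + 1) 1)

theorem opX_single (i j : ℕ) (r : R) : opX R (Finsupp.single (i, j) r) =
    Finsupp.single (i + 1, j) r := by
  simp [opX]

theorem opY_single (i j : ℕ) (r : R) : opY R (Finsupp.single (i, j) r) =
    Finsupp.single (i - 1, j) (r * i) + Finsupp.single (i, j + 1) r := by
  simp [opY]

theorem op_rel : opY R * opX R = opX R * opY R + 1 := by
  apply Finsupp.lhom_ext
  rintro ⟨i, j⟩ r
  simp only [Module.End.mul_apply, LinearMap.add_apply, Module.End.one_apply, opX_single,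
    opY_single, map_add]
  rcases i with _ | i
  · simp
    abel
  · simp [mul_add, Finsupp.single_add]
    abel

def rho (R : Type) [CommRing R] : WA R →ₐ[R] Module.End R (ℕ × ℕ →₀ R) :=
  wlift (opX R) (opY R) op_rel

def co : WA R →ₗ[R] (ℕ × ℕ →₀ R) where
  toFun w := rho R w (Finsupp.single (0, 0) 1)
  map_add' a b := by simp
  map_smul' a b := by simp

def mo (R : Type) [CommRing R] (I : ℕ × ℕ) : WA R := wx R ^ I.1 * wy R ^ I.2

def ta (R : Type) [CommRing R] : (ℕ × ℕ →₀ R) →ₗ[R] WA R := Finsupp.linearCombination R (mo R)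

theorem ta_single (I : ℕ × ℕ) (r : R) : ta R (Finsupp.single I r) = r • mo R I := by
  simp [ta]

theorem Wy_mul_pow (n : ℕ) : wy R * wx R ^ n = wx R ^ n * wy R + (n : R) • wx R ^ (n - 1) := by
  induction n with
  | zero => simp
  | succ n ih =>
    rw [pow_succ, ← mul_assoc, ih, add_mul, mul_assoc, W_rel]
    rcases n with _ | n
    · simp
    · simp [mul_add, add_smul, add_mul, pow_succ, mul_assoc]
      abel

theorem Wypow_mul (n : ℕ) : wy R ^ n * wx R = wx R * wy R ^ n + (n : R) • wy R ^ (n - 1) := by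
  induction n with
  | zero => simp
  | succ n ih =>
    rw [pow_succ', mul_assoc, ih, mul_add, ← mul_assoc, W_rel]
    rcases n with _ | n
    · simp
    · simp [add_mul, mul_add, add_smul, pow_succ', mul_assoc]
      abel

theorem ta_rho (w : WA R) : ∀ v, ta R (rho R w v) = w * ta R v := by
  induction w using W_induction with
  | h0 r => intro v; simp [Algebra.smul_def]
  | hx =>
    intro v
    have : (ta R).comp (opX R) = (LinearMap.mulLeft R (wx R)).comp (ta R) := by
      apply Finsupp.lhom_ext
      rintro ⟨i, j⟩ r
      simp [opX_single, ta_single, mo, pow_succ', mul_assoc]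
    simpa [rho, wlift_x] using LinearMap.congr_fun this v
  | hy =>
    intro v
    have : (ta R).comp (opY R) = (LinearMap.mulLeft R (wy R)).comp (ta R) := by
      apply Finsupp.lhom_ext
      rintro ⟨i, j⟩ r
      simp only [LinearMap.comp_apply, opY_single, map_add, ta_single, mo,
        LinearMap.mulLeft_apply, mul_smul_comm]
      rw [← mul_assoc (wy R), Wy_mul_pow, add_mul, smul_add, mul_assoc, add_comm, mul_smul,
        smul_mul_assoc, pow_succ']
    simpa [rho, wlift_y] using LinearMap.congr_fun this v
  | ha a b h1 h2 => intro v; simp [h1, h2, add_mul]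
  | hm a b h1 h2 => intro v; simp [h1, h2, mul_assoc]

theorem ta_co (w : WA R) : ta R (co w) = w := by
  have := ta_rho w (Finsupp.single (0, 0) 1)
  rw [ta_single] at this
  refine Eq.trans this ?_
  simp [mo]

theorem rho_x : rho R (wx R) = opX R := wlift_x _ _ _
theorem rho_y : rho R (wy R) = opY R := wlift_y _ _ _

theorem co_mo (I : ℕ × ℕ) : co (mo R I) = Finsupp.single I 1 := by
  obtain ⟨i, j⟩ := I
  have hy : ∀ j, (opY R ^ j) (Finsupp.single (0, 0) 1) = Finsupp.single (0, j) 1 := by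
    intro j
    induction j with
    | zero => simp
    | succ j ih => rw [pow_succ', Module.End.mul_apply, ih, opY_single]; simp
  have hx : ∀ i, (opX R ^ i) (Finsupp.single (0, j) 1) = Finsupp.single (i, j) 1 := by
    intro i
    induction i with
    | zero => simp
    | succ j ih => rw [pow_succ', Module.End.mul_apply, ih, opX_single]
  simp [co, mo, rho_x, rho_y, hy, hx]

theorem co_ta (v : ℕ × ℕ →₀ R) : co (ta R v) = v := by
  have : (co).comp (ta R) = LinearMap.id := by
    apply Finsupp.lhom_ext
    rintro I r
    simp [ta_single, co_mo]
  exact LinearMap.congr_fun this v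

theorem co_inj {a b : WA R} (h : ∀ I, co a I = co b I) : a = b := by
  rw [← ta_co a, ← ta_co b]
  congr 1
  ext I
  exact h I

theorem mo_induction {C : WA R → Prop} (hm : ∀ (r : R) I, C (r • mo R I)) (h0 : C 0)
    (ha : ∀ a b, C a → C b → C (a + b)) (w : WA R) : C w := by
  rw [← ta_co w]
  induction co w using Finsupp.induction_linear with
  | zero => simpa using h0
  | add f g h1 h2 => rw [map_add]; exact ha _ _ h1 h2
  | single I r => rw [ta_single]; exact hm r I

theorem co_mul_y (w : WA R) (a b : ℕ) :
    co (w * wy R) (a, b) = if b = 0 then 0 else co w (a, b - 1) := by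
  induction w using mo_induction with
  | h0 => simp
  | ha u v h1 h2 => rw [add_mul, map_add, map_add, Finsupp.add_apply, Finsupp.add_apply, h1, h2]; split_ifs <;> simp
  | hm r I =>
    obtain ⟨i, j⟩ := I
    have : mo R (i, j) * wy R = mo R (i, j + 1) := by simp [mo, pow_succ, mul_assoc]
    rw [smul_mul_assoc, this, map_smul, map_smul, co_mo, co_mo]
    rcases b with _ | b <;> simp [Finsupp.single_apply]

theorem co_x_mul (w : WA R) (a b : ℕ) :
    co (wx R * w) (a, b) = if a = 0 then 0 else co w (a - 1, b) := by
  induction w using mo_induction with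
  | h0 => simp
  | ha u v h1 h2 => rw [mul_add, map_add, map_add, Finsupp.add_apply, Finsupp.add_apply, h1, h2]; split_ifs <;> simp
  | hm r I =>
    obtain ⟨i, j⟩ := I
    have : wx R * mo R (i, j) = mo R (i + 1, j) := by simp [mo, pow_succ', mul_assoc]
    rw [mul_smul_comm, this, map_smul, map_smul, co_mo, co_mo]
    rcases a with _ | a <;> simp [Finsupp.single_apply]

theorem co_bracket_y (w : WA R) (a b : ℕ) :
    co (wy R * w - w * wy R) (a, b) = (a + 1 : R) * co w (a + 1, b) := by
  induction w using mo_induction with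
  | h0 => simp
  | ha u v h1 h2 =>
    rw [show wy R * (u + v) - (u + v) * wy R = (wy R * u - u * wy R) + (wy R * v - v * wy R) by
      noncomm_ring, map_add, map_add, Finsupp.add_apply, Finsupp.add_apply, h1, h2]; ring
  | hm r I =>
    obtain ⟨i, j⟩ := I
    have : wy R * mo R (i, j) - mo R (i, j) * wy R = (i : R) • mo R (i - 1, j) := by
      simp only [mo]
      rw [← mul_assoc, Wy_mul_pow, add_mul, mul_assoc, mul_assoc, ← pow_succ', ← pow_succ]
      simp
    rw [smul_mul_assoc, mul_smul_comm, ← smul_sub, this, map_smul, map_smul, map_smul, co_mo, co_mo]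
    rcases i with _ | i
    · simp
    · simp only [Finsupp.smul_apply, Finsupp.single_apply]
      simp
      split_ifs with h
      · obtain ⟨h1, h2⟩ := h; subst h1; ring
      · simp

theorem co_bracket_x (w : WA R) (a b : ℕ) :
    co (w * wx R - wx R * w) (a, b) = (b + 1 : R) * co w (a, b + 1) := by
  induction w using mo_induction with
  | h0 => simp
  | ha u v h1 h2 =>
    rw [show (u + v) * wx R - wx R * (u + v) = (u * wx R - wx R * u) + (v * wx R - wx R * v) by
      noncomm_ring, map_add, map_add, Finsupp.add_apply, Finsupp.add_apply, h1, h2]; ring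
  | hm r I =>
    obtain ⟨i, j⟩ := I
    have : mo R (i, j) * wx R - wx R * mo R (i, j) = (j : R) • mo R (i, j - 1) := by
      simp only [mo]
      rw [mul_assoc, Wypow_mul, mul_add, ← mul_assoc, ← mul_assoc, ← pow_succ', ← pow_succ]
      simp
    rw [smul_mul_assoc, mul_smul_comm, ← smul_sub, this, map_smul, map_smul, map_smul, co_mo, co_mo]
    rcases j with _ | i
    · simp
    · simp only [Finsupp.smul_apply, Finsupp.single_apply]
      simp
      split_ifs with h
      · obtain ⟨h1, h2⟩ := h; subst h2; ring
      · simp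

theorem co_y_mul (w : WA R) (a b : ℕ) :
    co (wy R * w) (a, b) = (a + 1 : R) * co w (a + 1, b) + if b = 0 then 0 else co w (a, b - 1) := by
  rw [← co_bracket_y, ← co_mul_y, ← Finsupp.add_apply, ← map_add, sub_add_cancel]

end WeylBasics

section WeylTwo

variable {R : Type} [CommRing R]

theorem co_mo_mul_mo (I J : ℕ × ℕ) :
    (∀ a b, co (mo R I * mo R J) (a, b) ≠ 0 → ∃ r, a + r = I.1 + J.1 ∧ b + r = I.2 + J.2) ∧
    co (mo R I * mo R J) (I.1 + J.1, I.2 + J.2) = 1 := by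
  obtain ⟨i, j⟩ := I
  obtain ⟨k, l⟩ := J
  simp only [mo]
  have h1 : ∀ j, (∀ a b, co (wy R ^ j * mo R (k, l)) (a, b) ≠ 0 →
      ∃ r, a + r = k ∧ b + r = j + l) ∧ co (wy R ^ j * mo R (k, l)) (k, j + l) = 1 := by
    intro j
    induction j with
    | zero =>
      simp only [pow_zero, one_mul, co_mo, zero_add]
      refine ⟨?_, by simp⟩
      intro a b h
      rw [Finsupp.single_apply] at h
      have h2 : (k, l) = (a, b) := by
        by_contra h3
        simp [h3] at h
      cases h2
      exact ⟨0, by simp⟩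
    | succ j ih =>
      obtain ⟨ih1, ih2⟩ := ih
      rw [pow_succ', mul_assoc]
      refine ⟨?_, ?_⟩
      · intro a b h
        rw [co_y_mul] at h
        by_cases h3 : co (wy R ^ j * mo R (k, l)) (a + 1, b) = 0
        · rw [h3] at h
          split_ifs at h with hb
          · simp at h
          · obtain ⟨r, h4, h5⟩ := ih1 a (b - 1) (by simpa using h)
            exact ⟨r, by omega, by omega⟩
        · obtain ⟨r, h4, h5⟩ := ih1 _ _ h3
          exact ⟨r + 1, by omega, by omega⟩
      · rw [co_y_mul]
        have h3 : co (wy R ^ j * mo R (k, l)) (k + 1, j + 1 + l) = 0 := by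
          by_contra h3
          obtain ⟨r, h4, h5⟩ := ih1 _ _ h3
          omega
        rw [h3, mul_zero, zero_add, if_neg (by omega), show j + 1 + l - 1 = j + l by omega, ih2]
  induction i with
  | zero =>
    have := h1 j
    simpa [mo] using this
  | succ i ih =>
    obtain ⟨ih1, ih2⟩ := ih
    rw [pow_succ', mul_assoc, mul_assoc]
    rw [mul_assoc] at ih1 ih2
    refine ⟨?_, ?_⟩
    · intro a b h
      rw [co_x_mul] at h
      split_ifs at h with ha
      · simp at h
      · obtain ⟨r, h4, h5⟩ := ih1 _ _ h
        exact ⟨r, by omega, h5⟩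
    · rw [co_x_mul, if_neg (by omega)]
      rw [show i + 1 + k - 1 = i + k by omega]
      exact ih2

theorem sum_mo (w : WA R) : w = ∑ I ∈ (co w).support, co w I • mo R I := by
  conv_lhs => rw [← ta_co w]
  rw [ta, Finsupp.linearCombination_apply, Finsupp.sum]

theorem co_mul_eq (w v : WA R) (L : ℕ × ℕ) : co (w * v) L =
    ∑ I ∈ (co w).support, ∑ J ∈ (co v).support, co w I * co v J * co (mo R I * mo R J) L := by
  conv_lhs => rw [sum_mo w, sum_mo v, Finset.sum_mul_sum]
  simp only [map_sum, Finsupp.finsetSum_apply, smul_mul_smul_comm, map_smul, Finsupp.smul_apply,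
    smul_eq_mul]

theorem co_mul_support {w v : WA R} {a b : ℕ} (h : co (w * v) (a, b) ≠ 0) :
    ∃ I J r, co w I ≠ 0 ∧ co v J ≠ 0 ∧ a + r = I.1 + J.1 ∧ b + r = I.2 + J.2 := by
  rw [co_mul_eq] at h
  obtain ⟨I, hI, h⟩ := Finset.exists_ne_zero_of_sum_ne_zero h
  obtain ⟨J, hJ, h⟩ := Finset.exists_ne_zero_of_sum_ne_zero h
  obtain ⟨r, h1, h2⟩ := (co_mo_mul_mo I J).1 a b (right_ne_zero_of_mul h)
  exact ⟨I, J, r, by simpa using hI, by simpa using hJ, h1, h2⟩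

def IsLead (A B : ℕ) (w : WA R) (I0 : ℕ × ℕ) : Prop :=
  ∀ I, co w I ≠ 0 → I ≠ I0 → A * I.1 + B * I.2 < A * I0.1 + B * I0.2

theorem IsLead.mul {A B : ℕ} (hAB : 0 < A + B) {w v : WA R} {I0 J0 : ℕ × ℕ}
    (hw : IsLead A B w I0) (hv : IsLead A B v J0) :
    IsLead A B (w * v) (I0 + J0) ∧ co (w * v) (I0 + J0) = co w I0 * co v J0 := by
  have key : ∀ I J r a b, co w I ≠ 0 → co v J ≠ 0 → a + r = I.1 + J.1 → b + r = I.2 + J.2 →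
      (A * a + B * b < A * (I0 + J0).1 + B * (I0 + J0).2) ∨ (I = I0 ∧ J = J0 ∧ r = 0) := by
    intro I J r a b hI hJ h1 h2
    have e : A * a + B * b + (A + B) * r = (A * I.1 + B * I.2) + (A * J.1 + B * J.2) := by
      calc A * a + B * b + (A + B) * r = A * (a + r) + B * (b + r) := by ring
        _ = _ := by rw [h1, h2]; ring
    have e2 : A * (I0 + J0).1 + B * (I0 + J0).2 = (A * I0.1 + B * I0.2) + (A * J0.1 + B * J0.2) := by
      simp only [Prod.fst_add, Prod.snd_add]; ring
    rw [e2]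
    have hI' := hw I hI
    have hJ' := hv J hJ
    by_cases c1 : I = I0
    · by_cases c2 : J = J0
      · rcases Nat.eq_zero_or_pos r with hr | hr
        · exact Or.inr ⟨c1, c2, hr⟩
        · left
          have := Nat.mul_pos hAB hr
          rw [c1, c2] at e
          omega
      · left
        have := hJ' c2
        rw [c1] at e
        omega
    · left
      have := hI' c1
      by_cases c2 : J = J0
      · rw [c2] at e
        omega
      · have := hJ' c2
        omega
  constructor
  · rintro ⟨a, b⟩ h hne
    obtain ⟨I, J, r, hI, hJ, h1, h2⟩ := co_mul_support h
    rcases key I J r a b hI hJ h1 h2 with h3 | ⟨rfl, rfl, rfl⟩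
    · exact h3
    · exfalso
      apply hne
      ext
      · simpa using h1
      · simpa using h2
  · have hz : ∀ I J, co w I ≠ 0 → co v J ≠ 0 → (I ≠ I0 ∨ J ≠ J0) →
        co (mo R I * mo R J) (I0 + J0) = 0 := by
      intro I J hI hJ hne
      by_contra h
      obtain ⟨r, h1, h2⟩ := (co_mo_mul_mo I J).1 _ _ h
      rcases key I J r _ _ hI hJ h1 h2 with h3 | ⟨rfl, rfl, rfl⟩
      · simp at h3
      · simp at hne
    rw [co_mul_eq]
    rw [Finset.sum_eq_single I0, Finset.sum_eq_single J0]
    · have := (co_mo_mul_mo (R := R) I0 J0).2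
      rw [show I0 + J0 = (I0.1 + J0.1, I0.2 + J0.2) from rfl, this, mul_one]
    · intro J hJ hne
      by_cases hI0 : co w I0 = 0
      · simp [hI0]
      · rw [hz I0 J hI0 (by simpa using hJ) (Or.inr hne), mul_zero]
    · intro h
      have : co v J0 = 0 := by simpa using h
      simp [this]
    · intro I hI hne
      apply Finset.sum_eq_zero
      intro J hJ
      rw [hz I J (by simpa using hI) (by simpa using hJ) (Or.inl hne), mul_zero]
    · intro h
      have : co w I0 = 0 := by simpa using h
      simp [this]

theorem co_one (I : ℕ × ℕ) : co (1 : WA R) I = if I = (0, 0) then 1 else 0 := by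
  have : (1 : WA R) = mo R (0, 0) := by simp [mo]
  rw [this, co_mo, Finsupp.single_apply]
  simp [eq_comm]

theorem IsLead.pow {A B : ℕ} (hAB : 0 < A + B) {w : WA R} {I0 : ℕ × ℕ}
    (hw : IsLead A B w I0) (n : ℕ) :
    IsLead A B (w ^ n) (n • I0) ∧ co (w ^ n) (n • I0) = co w I0 ^ n := by
  induction n with
  | zero =>
    refine ⟨?_, ?_⟩
    · intro I h hne
      rw [pow_zero, co_one] at h
      simp at h hne
      exact absurd h.1 hne
    · rw [pow_zero, zero_smul, co_one, pow_zero]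
      exact if_pos rfl
  | succ n ih =>
    have := IsLead.mul hAB ih.1 hw
    rw [pow_succ, succ_nsmul, pow_succ, ← ih.2]
    exact this

theorem exists_lead {w : WA R} (hw : w ≠ 0) (M : ℕ) (hM : ∀ I, co w I ≠ 0 → I.2 ≤ M) :
    ∃ I0, co w I0 ≠ 0 ∧ IsLead (M + 1) 1 w I0 := by
  have hne : (co w).support.Nonempty := by
    rw [Finset.nonempty_iff_ne_empty]
    intro h
    apply hw
    apply co_inj
    intro I
    rw [map_zero]
    by_contra h2
    have : I ∈ (co w).support := by simpa using h2
    simp [h] at this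
  obtain ⟨I0, h0, hmax⟩ := Finset.exists_max_image _ (fun I : ℕ × ℕ => (M + 1) * I.1 + 1 * I.2) hne
  refine ⟨I0, by simpa using h0, ?_⟩
  intro I hI hne
  have h1 := hmax I (by simpa using hI)
  refine lt_of_le_of_ne h1 ?_
  intro he
  apply hne
  have a1 := hM I hI
  have a2 := hM I0 (by simpa using h0)
  have h3 : I.1 = I0.1 := by
    rcases lt_trichotomy I.1 I0.1 with h | h | h
    · have : (M + 1) * (I.1 + 1) ≤ (M + 1) * I0.1 := Nat.mul_le_mul_left _ h
      rw [mul_add] at this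
      omega
    · exact h
    · have : (M + 1) * (I0.1 + 1) ≤ (M + 1) * I.1 := Nat.mul_le_mul_left _ h
      rw [mul_add] at this
      omega
  rw [h3] at he
  exact Prod.ext h3 (by omega)

theorem exists_bound (w : WA R) : ∃ M, ∀ I, co w I ≠ 0 → I.1 + I.2 ≤ M := by
  refine ⟨(co w).support.sup (fun I => I.1 + I.2), ?_⟩
  intro I h
  exact Finset.le_sup (f := fun I : ℕ × ℕ => I.1 + I.2) (by simpa using h)

theorem WA_mul_ne [IsDomain R] {w v : WA R} (hw : w ≠ 0) (hv : v ≠ 0) : w * v ≠ 0 := by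
  obtain ⟨M, hM⟩ := exists_bound w
  obtain ⟨M', hM'⟩ := exists_bound v
  obtain ⟨I, hI, lI⟩ := exists_lead hw (M + M') (fun I h => by have := hM I h; omega)
  obtain ⟨J, hJ, lJ⟩ := exists_lead hv (M + M') (fun I h => by have := hM' I h; omega)
  have := (IsLead.mul (by omega) lI lJ).2
  intro h
  rw [h] at this
  simp at this
  tauto

theorem deg_mul {w v : WA R} {M N : ℕ} (hw : ∀ I, co w I ≠ 0 → I.1 + I.2 ≤ M)
    (hv : ∀ I, co v I ≠ 0 → I.1 + I.2 ≤ N) : ∀ I, co (w * v) I ≠ 0 → I.1 + I.2 ≤ M + N := by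
  rintro ⟨a, b⟩ h
  obtain ⟨I, J, r, hI, hJ, h1, h2⟩ := co_mul_support h
  have := hw I hI
  have := hv J hJ
  simp only
  omega

theorem deg_pow {w : WA R} {N : ℕ} (hw : ∀ I, co w I ≠ 0 → I.1 + I.2 ≤ N) (n : ℕ) :
    ∀ I, co (w ^ n) I ≠ 0 → I.1 + I.2 ≤ n * N := by
  induction n with
  | zero =>
    intro I h
    rw [pow_zero, co_one] at h
    simp at h
    rw [h.1]
    simp
  | succ n ih =>
    intro I h
    rw [pow_succ] at h
    have := deg_mul ih hw I h
    rw [add_mul, one_mul]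
    exact this

def starH (R : Type) [CommRing R] : WA R →ₐ[R] (WA R)ᵐᵒᵖ :=
  wlift (MulOpposite.op (wx R)) (MulOpposite.op (-wy R)) (by
    rw [← MulOpposite.op_mul, ← MulOpposite.op_mul, ← MulOpposite.op_one, ← MulOpposite.op_add]
    congr 1
    rw [neg_mul, W_rel]
    noncomm_ring)

def st (w : WA R) : WA R := MulOpposite.unop (starH R w)

theorem st_x : st (wx R) = wx R := by simp [st, starH, wlift_x]
theorem st_y : st (wy R) = -wy R := by simp [st, starH, wlift_y]
theorem st_add (a b : WA R) : st (a + b) = st a + st b := by simp [st]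
theorem st_mul (a b : WA R) : st (a * b) = st b * st a := by simp [st]
theorem st_smul (r : R) (a : WA R) : st (r • a) = r • st a := by simp [st]
theorem st_one : st (1 : WA R) = 1 := by simp [st]
theorem st_zero : st (0 : WA R) = 0 := by simp [st]
theorem st_neg (a : WA R) : st (-a) = -st a := by simp [st]
theorem st_sub (a b : WA R) : st (a - b) = st a - st b := by simp [st]
theorem st_pow (a : WA R) (n : ℕ) : st (a ^ n) = st a ^ n := by simp [st]
theorem st_algebraMap (r : R) : st (algebraMap R (WA R) r) = algebraMap R (WA R) r := by
  rw [Algebra.algebraMap_eq_smul_one, st_smul, st_one]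
theorem st_st (a : WA R) : st (st a) = a := by
  induction a using W_induction with
  | h0 r => rw [st_algebraMap, st_algebraMap]
  | hx => rw [st_x, st_x]
  | hy => rw [st_y, st_neg, st_y, neg_neg]
  | ha a b h1 h2 => rw [st_add, st_add, h1, h2]
  | hm a b h1 h2 => rw [st_mul, st_mul, h1, h2]

variable {S : Type} [CommRing S]

def wmap (φ : R →+* S) : WA R →+* WA S := (exists_wmap φ).choose
theorem wmap_x (φ : R →+* S) : wmap φ (wx R) = wx S := (exists_wmap φ).choose_spec.1
theorem wmap_y (φ : R →+* S) : wmap φ (wy R) = wy S := (exists_wmap φ).choose_spec.2.1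
theorem wmap_smul (φ : R →+* S) (r : R) (w : WA R) : wmap φ (r • w) = φ r • wmap φ w :=
  (exists_wmap φ).choose_spec.2.2 r w
theorem wmap_mo (φ : R →+* S) (I : ℕ × ℕ) : wmap φ (mo R I) = mo S I := by
  simp [mo, wmap_x, wmap_y]
theorem co_wmap (φ : R →+* S) (w : WA R) (I : ℕ × ℕ) : co (wmap φ w) I = φ (co w I) := by
  induction w using mo_induction with
  | h0 => simp
  | ha a b h1 h2 => simp [h1, h2]
  | hm r J =>
    rw [wmap_smul, wmap_mo, map_smul, map_smul, co_mo, co_mo]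
    simp [Finsupp.single_apply, apply_ite φ]
theorem wmap_st (φ : R →+* S) (w : WA R) : wmap φ (st w) = st (wmap φ w) := by
  induction w using W_induction with
  | h0 r => rw [Algebra.algebraMap_eq_smul_one, st_smul, st_one, wmap_smul, map_one, st_smul, st_one]
  | hx => rw [st_x, wmap_x, st_x]
  | hy => rw [st_y, map_neg, wmap_y, st_y]
  | ha a b h1 h2 => rw [st_add, map_add, map_add, st_add, h1, h2]
  | hm a b h1 h2 => rw [st_mul, map_mul, map_mul, st_mul, h1, h2]

end WeylTwo

section WeylThree

theorem gen_mul_pow {A : Type} [Ring A] {p q : A} (h : q * p = p * q + 1) (n : ℕ) :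
    q * p ^ n = p ^ n * q + (n : A) * p ^ (n - 1) := by
  have := congrArg (wlift (R := ℤ) p q h) (Wy_mul_pow (R := ℤ) n)
  simpa [wlift_x, wlift_y] using this

theorem gen_pow_mul {A : Type} [Ring A] {p q : A} (h : q * p = p * q + 1) (n : ℕ) :
    q ^ n * p = p * q ^ n + (n : A) * q ^ (n - 1) := by
  have := congrArg (wlift (R := ℤ) p q h) (Wypow_mul (R := ℤ) n)
  simpa [wlift_x, wlift_y] using this

theorem indep_aux {A : Type} [Ring A] (D : A →+ A) (b : A) (p : ℕ)
    (hD : ∀ (u : A) (j : ℕ), D u = 0 → D (u * b ^ j) = (j : A) * (u * b ^ (j - 1)))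
    (hp : ∀ (j : ℕ) (u : A), 0 < j → j < p → (j : A) * u = 0 → u = 0)
    (hD' : ∀ (j : ℕ) (u : A), D u = 0 → D ((j : A) * u) = 0) (n : ℕ) (hn : n ≤ p) :
    ∀ u : ℕ → A, (∀ j, D (u j) = 0) → ∑ j ∈ Finset.range n, u j * b ^ j = 0 →
      ∀ j < n, u j = 0 := by
  induction n with
  | zero => intro u _ _ j hj; omega
  | succ n ih =>
    intro u hu hs
    have h1 := congrArg D hs
    rw [map_sum, map_zero, Finset.sum_range_succ', hD _ _ (hu 0)] at h1
    simp only [Nat.cast_zero, zero_mul, add_zero] at h1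
    have h2 := ih (by omega) (fun j => ((j + 1 : ℕ) : A) * u (j + 1)) (fun j => hD' _ _ (hu _)) (by
      rw [← h1]
      apply Finset.sum_congr rfl
      intro j _
      rw [hD _ _ (hu _), mul_assoc]
      simp)
    have h3 : ∀ j < n, u (j + 1) = 0 := fun j hj => hp (j + 1) _ (by omega) (by omega) (h2 j hj)
    intro j hj
    rcases j with _ | j
    · rw [Finset.sum_range_succ'] at hs
      rw [Finset.sum_eq_zero] at hs
      · simpa using hs
      · intro j hj
        rw [h3 j (by simpa using hj), zero_mul]
    · exact h3 j (by omega)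

variable {p : ℕ} [hp : Fact p.Prime]

theorem WA_natCast_p (n : ℕ) (h : (n : ZMod p) = 0) : (n : WA (ZMod p)) = 0 := by
  have : (n : WA (ZMod p)) = algebraMap (ZMod p) (WA (ZMod p)) (n : ZMod p) := by simp
  rw [this, h, map_zero]

theorem WA_cancel (j : ℕ) (u : WA (ZMod p)) (h0 : 0 < j) (h1 : j < p)
    (h : (j : WA (ZMod p)) * u = 0) : u = 0 := by
  have h2 : (j : ZMod p) ≠ 0 := by
    intro h3
    rw [ZMod.natCast_eq_zero_iff] at h3
    exact absurd (Nat.le_of_dvd h0 h3) (by omega)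
  have h4 : (j : WA (ZMod p)) = algebraMap (ZMod p) (WA (ZMod p)) (j : ZMod p) := by simp
  rw [h4, ← Algebra.smul_def] at h
  calc u = ((j : ZMod p)⁻¹ * (j : ZMod p)) • u := by rw [inv_mul_cancel₀ h2, one_smul]
    _ = 0 := by rw [mul_smul, h, smul_zero]

theorem indep_PQ {P Q : WA (ZMod p)} (h : Q * P = P * Q + 1) (z : ℕ → ℕ → WA (ZMod p))
    (hz : ∀ i j w, z i j * w = w * z i j)
    (hs : ∑ j ∈ Finset.range p, (∑ i ∈ Finset.range p, z i j * P ^ i) * Q ^ j = 0) :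
    ∀ i < p, ∀ j < p, z i j = 0 := by
  have h1 := indep_aux (A := WA (ZMod p)) (AddMonoidHom.mulRight P - AddMonoidHom.mulLeft P) Q p
    (by
      intro u j hu
      simp only [AddMonoidHom.sub_apply, AddMonoidHom.coe_mulRight, AddMonoidHom.coe_mulLeft] at hu ⊢
      rw [mul_assoc, gen_pow_mul h, mul_add, ← mul_assoc, ← mul_assoc, ← mul_assoc,
        sub_eq_zero.mp hu, ← mul_assoc, (Nat.cast_commute j u).eq]
      abel)
    WA_cancel
    (by
      intro j u hu
      simp only [AddMonoidHom.sub_apply, AddMonoidHom.coe_mulRight, AddMonoidHom.coe_mulLeft] at hu ⊢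
      rw [← mul_assoc, ← (Nat.cast_commute j P).eq, mul_assoc, mul_assoc, ← mul_sub, hu, mul_zero])
    p le_rfl (fun j => ∑ i ∈ Finset.range p, z i j * P ^ i)
    (by
      intro j
      simp only [AddMonoidHom.sub_apply, AddMonoidHom.coe_mulRight, AddMonoidHom.coe_mulLeft]
      rw [Finset.sum_mul, Finset.mul_sum, sub_eq_zero]
      apply Finset.sum_congr rfl
      intro i _
      rw [← mul_assoc, ← hz, mul_assoc, mul_assoc, ← pow_succ, ← pow_succ'])
    hs
  intro i hi j hj
  exact indep_aux (A := WA (ZMod p)) (AddMonoidHom.mulLeft Q - AddMonoidHom.mulRight Q) P p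
    (by
      intro u j hu
      simp only [AddMonoidHom.sub_apply, AddMonoidHom.coe_mulRight, AddMonoidHom.coe_mulLeft] at hu ⊢
      rw [mul_assoc u, ← mul_assoc Q, sub_eq_zero.mp hu, mul_assoc, gen_mul_pow h, mul_add,
        ← mul_assoc u (j : WA (ZMod p)), ← mul_assoc (j : WA (ZMod p)), (Nat.cast_commute j u).eq]
      abel)
    WA_cancel
    (by
      intro j u hu
      simp only [AddMonoidHom.sub_apply, AddMonoidHom.coe_mulRight, AddMonoidHom.coe_mulLeft] at hu ⊢
      rw [← mul_assoc, ← (Nat.cast_commute j Q).eq, mul_assoc, mul_assoc, ← mul_sub, hu, mul_zero])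
    p le_rfl (fun i => z i j)
    (by
      intro i
      simp only [AddMonoidHom.sub_apply, AddMonoidHom.coe_mulRight, AddMonoidHom.coe_mulLeft]
      rw [hz, sub_self])
    (h1 j hj) i hi

theorem central_of_xy {w : WA (ZMod p)} (hx : w * wx _ = wx _ * w) (hy : w * wy _ = wy _ * w) :
    w ∈ Subring.center (WA (ZMod p)) := by
  rw [Subring.mem_center_iff]
  intro g
  induction g using W_induction with
  | h0 r => exact Algebra.commutes _ _
  | hx => exact hx.symm
  | hy => exact hy.symm
  | ha a b h1 h2 => rw [add_mul, mul_add, h1, h2]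
  | hm a b h1 h2 => rw [mul_assoc, h2, ← mul_assoc, h1, mul_assoc]

theorem xp_central : wx (ZMod p) ^ p ∈ Subring.center (WA (ZMod p)) := by
  apply central_of_xy
  · rw [← pow_succ, ← pow_succ']
  · rw [gen_mul_pow W_rel, WA_natCast_p p (by simp)]
    simp

theorem yp_central : wy (ZMod p) ^ p ∈ Subring.center (WA (ZMod p)) := by
  apply central_of_xy
  · rw [gen_pow_mul W_rel, WA_natCast_p p (by simp)]
    simp
  · rw [← pow_succ, ← pow_succ']

instance : Nontrivial (WA (ZMod p)) := by
  refine ⟨1, 0, ?_⟩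
  intro h
  have := congrArg (fun w => co w (0, 0)) h
  simp [co_one] at this

open Classical in
theorem span_center : Submodule.span (Subring.center (WA (ZMod p)))
    (((Finset.range p ×ˢ Finset.range p).image (mo (ZMod p)) : Finset (WA (ZMod p))) : Set (WA (ZMod p))) = ⊤ := by
  rw [eq_top_iff]
  rintro w -
  have hpos : 0 < p := hp.out.pos
  induction w using mo_induction with
  | h0 => exact zero_mem _
  | ha a b h1 h2 => exact add_mem (h1) (h2)
  | hm r I =>
    obtain ⟨i, j⟩ := I
    have hc : r • ((wx (ZMod p) ^ p) ^ (i / p) * (wy (ZMod p) ^ p) ^ (j / p)) ∈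
        Subring.center (WA (ZMod p)) := by
      rw [Algebra.smul_def]
      refine mul_mem ?_ (mul_mem (pow_mem xp_central _) (pow_mem yp_central _))
      rw [Subring.mem_center_iff]
      intro g
      exact (Algebra.commutes _ _).symm
    have he : r • mo (ZMod p) (i, j) =
        (⟨_, hc⟩ : Subring.center (WA (ZMod p))) • mo (ZMod p) (i % p, j % p) := by
      rw [Subring.smul_def, smul_eq_mul, smul_mul_assoc]
      congr 1
      simp only [mo]
      have hy := Subring.mem_center_iff.mp (pow_mem (yp_central (p := p)) (j / p))
      rw [mul_assoc, ← mul_assoc _ _ (wy _ ^ (j % p)), ← hy, ← mul_assoc, ← mul_assoc, ← pow_mul,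
        ← pow_add, mul_assoc, ← pow_mul, ← pow_add, Nat.div_add_mod, Nat.div_add_mod]
    rw [he]
    apply Submodule.smul_mem
    apply Submodule.subset_span
    simp only [Finset.coe_image]
    exact ⟨(i % p, j % p), by simp [Nat.mod_lt _ hpos], rfl⟩

theorem dep_exists (P Q w : WA (ZMod p)) (h : Q * P = P * Q + 1) :
    ∃ (z0 : WA (ZMod p)) (z : ℕ → ℕ → WA (ZMod p)), z0 ≠ 0 ∧ (∀ v, z0 * v = v * z0) ∧
      (∀ i j v, z i j * v = v * z i j) ∧
      z0 * w + ∑ j ∈ Finset.range p, (∑ i ∈ Finset.range p, z i j * P ^ i) * Q ^ j = 0 := by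
  classical
  let v : Option (Fin p × Fin p) → WA (ZMod p) := fun o => o.elim w (fun x => P ^ (x.1 : ℕ) * Q ^ (x.2 : ℕ))
  have hnot : ¬ LinearIndependent (Subring.center (WA (ZMod p))) v := by
    intro hl
    have h1 := linearIndependent_le_span_finset v hl _ span_center
    have h2 : ((Finset.range p ×ˢ Finset.range p).image (mo (ZMod p))).card ≤ p * p := by
      refine Finset.card_image_le.trans ?_
      simp
    rw [Cardinal.mk_fintype, Nat.cast_le] at h1
    simp at h1
    exact absurd (h1.trans_le h2) (lt_irrefl _)
  rw [Fintype.not_linearIndependent_iff] at hnot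
  obtain ⟨g, hg, hne⟩ := hnot
  have hcen : ∀ o v, (g o : WA (ZMod p)) * v = v * g o := fun o v =>
    (Subring.mem_center_iff.mp (g o).2 v).symm
  let z : ℕ → ℕ → WA (ZMod p) := fun i j => if hij : i < p ∧ j < p then
    (g (some (⟨i, hij.1⟩, ⟨j, hij.2⟩)) : WA (ZMod p)) else 0
  have hz : ∀ i j v, z i j * v = v * z i j := by
    intro i j v
    simp only [z]
    split_ifs
    · exact hcen _ _
    · simp
  have hsum : (g none : WA (ZMod p)) * w +
      ∑ j ∈ Finset.range p, (∑ i ∈ Finset.range p, z i j * P ^ i) * Q ^ j = 0 := by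
    rw [Fintype.sum_option] at hg
    rw [← hg]
    congr 1
    rw [Fintype.sum_prod_type_right, ← Fin.sum_univ_eq_sum_range (fun j => (∑ i ∈ Finset.range p, z i j * P ^ i) * Q ^ j)]
    apply Finset.sum_congr rfl
    intro j _
    rw [← Fin.sum_univ_eq_sum_range (fun i => z i j * P ^ i), Finset.sum_mul]
    apply Finset.sum_congr rfl
    intro i _
    simp only [z, v, Subring.smul_def, smul_eq_mul]
    rw [dif_pos ⟨i.2, j.2⟩, mul_assoc]
    rfl
  refine ⟨g none, z, ?_, hcen none, hz, hsum⟩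
  intro h0
  rw [h0, zero_mul, zero_add] at hsum
  have h1 := indep_PQ h z hz hsum
  obtain ⟨o, ho⟩ := hne
  apply ho
  rcases o with _ | ⟨i, j⟩
  · exact Subtype.ext h0
  · apply Subtype.ext
    have := h1 i i.2 j j.2
    simpa [z] using this

theorem pow_central {P Q : WA (ZMod p)} (h : Q * P = P * Q + 1) (w : WA (ZMod p)) (c : WA (ZMod p))
    (hP : c * P = P * c) (hQ : c * Q = Q * c) : c * w = w * c := by
  obtain ⟨z0, z, h0, hz0, hz, hs⟩ := dep_exists P Q w h
  have h1 : z0 * w = - ∑ j ∈ Finset.range p, (∑ i ∈ Finset.range p, z i j * P ^ i) * Q ^ j :=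
    eq_neg_of_add_eq_zero_left hs
  have h2 : Commute c (z0 * w) := by
    rw [h1]
    apply Commute.neg_right
    apply Commute.sum_right
    intro j _
    apply Commute.mul_right
    · apply Commute.sum_right
      intro i _
      exact Commute.mul_right (hz i j c).symm (Commute.pow_right hP _)
    · exact Commute.pow_right hQ _
  have h3 : z0 * (c * w - w * c) = 0 := by
    rw [mul_sub, ← mul_assoc, ← mul_assoc, ← h2.eq, hz0, mul_assoc, sub_self]
  by_contra h4
  exact WA_mul_ne h0 (sub_ne_zero.mpr h4) h3

theorem Pp_central {P Q : WA (ZMod p)} (h : Q * P = P * Q + 1) (w : WA (ZMod p)) :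
    P ^ p * w = w * P ^ p := by
  apply pow_central h
  · rw [← pow_succ, ← pow_succ']
  · rw [gen_mul_pow h, WA_natCast_p p (by simp)]
    simp

theorem Qp_central {P Q : WA (ZMod p)} (h : Q * P = P * Q + 1) (w : WA (ZMod p)) :
    Q ^ p * w = w * Q ^ p := by
  apply pow_central h
  · rw [gen_pow_mul h, WA_natCast_p p (by simp)]
    simp
  · rw [← pow_succ, ← pow_succ']

theorem central_support {w : WA (ZMod p)} (hw : ∀ v, w * v = v * w) (I : ℕ × ℕ) (hI : co w I ≠ 0) :
    p ∣ I.1 ∧ p ∣ I.2 := by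
  obtain ⟨a, b⟩ := I
  constructor
  · rcases a with _ | a
    · simp
    · have h := co_bracket_y w a b
      rw [hw, sub_self, map_zero] at h
      have h2 : ((a + 1 : ℕ) : ZMod p) = 0 := by
        rcases mul_eq_zero.mp h.symm with h | h
        · exact_mod_cast h
        · exact absurd h hI
      rwa [ZMod.natCast_eq_zero_iff] at h2
  · rcases b with _ | b
    · simp
    · have h := co_bracket_x w a b
      rw [hw, sub_self, map_zero] at h
      have h2 : ((b + 1 : ℕ) : ZMod p) = 0 := by
        rcases mul_eq_zero.mp h.symm with h | h
        · exact_mod_cast h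
        · exact absurd h hI
      rwa [ZMod.natCast_eq_zero_iff] at h2

theorem st_central {w : WA (ZMod p)} (hw : ∀ v, w * v = v * w) (h2 : (2 : ZMod p) ≠ 0)
    (hst : st w = -w) (i : ℕ) : co w (i, 0) = 0 := by
  have hm : ∀ I : ℕ × ℕ, co w I ≠ 0 → st (mo (ZMod p) I) = ((-1) ^ I.2 : ZMod p) • mo (ZMod p) I := by
    rintro ⟨a, b⟩ hI
    obtain ⟨-, ⟨b, rfl⟩⟩ := central_support hw _ hI
    simp only [mo]
    rw [st_mul, st_pow, st_pow, st_x, st_y, neg_pow]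
    have : Commute (wy (ZMod p) ^ (p * b)) (wx (ZMod p) ^ a) := by
      rw [pow_mul]
      exact (Subring.mem_center_iff.mp (pow_mem yp_central b) _).symm
    rw [mul_assoc, this.eq, Algebra.smul_def]
    simp
  have hsum : ∀ (s : Finset (ℕ × ℕ)) (f : ℕ × ℕ → WA (ZMod p)), st (∑ I ∈ s, f I) = ∑ I ∈ s, st (f I) := by
    intro s f
    simp [st]
  have h3 : co (st w) (i, 0) = co w (i, 0) := by
    conv_lhs => rw [sum_mo w, hsum]
    rw [map_sum, Finsupp.finsetSum_apply, Finset.sum_eq_single (i, 0)]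
    · by_cases hI : co w (i, 0) = 0
      · rw [hI]; simp [st_zero]
      · rw [st_smul, hm _ hI, map_smul, map_smul, co_mo]
        simp
    · intro J hJ hne
      rw [st_smul, hm _ (by simpa using hJ), map_smul, map_smul, co_mo]
      simp [Finsupp.single_apply, hne]
    · intro h
      have : co w (i, 0) = 0 := by simpa using h
      rw [this]; simp [st_zero]
  rw [hst, map_neg, Finsupp.neg_apply] at h3
  have h4 : 2 * co w (i, 0) = 0 := by linear_combination -h3
  rcases mul_eq_zero.mp h4 with h | h
  · exact absurd h h2
  · exact h

end WeylThree

section WeylFour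

theorem gen_pow_pow {A : Type} [Ring A] {p q : A} (h : q * p = p * q + 1) (m n : ℕ) :
    q ^ m * p ^ n = ∑ k ∈ Finset.range (m + 1),
      ((m.choose k * n.descFactorial k : ℕ) : A) * (p ^ (n - k) * q ^ (m - k)) := by
  let L : Module.End ℤ A := LinearMap.mulLeft ℤ q
  let Rr : Module.End ℤ A := LinearMap.mulRight ℤ q
  let D : Module.End ℤ A := L - Rr
  have hD : ∀ k, (D ^ k) (p ^ n) = (n.descFactorial k : A) * p ^ (n - k) := by
    intro k
    induction k with
    | zero => simp
    | succ k ih =>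
      rw [pow_succ', Module.End.mul_apply, ih]
      simp only [D, L, Rr, LinearMap.sub_apply, LinearMap.mulLeft_apply, LinearMap.mulRight_apply]
      rw [← mul_assoc, ← (Nat.cast_commute _ q).eq, mul_assoc, mul_assoc, gen_mul_pow h, ← mul_sub,
        add_sub_cancel_left, Nat.descFactorial_succ, Nat.cast_mul, ← mul_assoc,
        ← (Nat.cast_commute _ _).eq, Nat.sub_sub]
  have hc : Commute D Rr := by
    apply LinearMap.ext
    intro x
    simp [D, L, Rr, mul_assoc, sub_mul]
  have h1 := hc.add_pow m
  have h2 : D + Rr = L := by simp [D]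
  rw [h2] at h1
  have h3 := LinearMap.congr_fun h1 (p ^ n)
  simp only [L, LinearMap.pow_mulLeft, LinearMap.mulLeft_apply] at h3
  rw [h3, LinearMap.sum_apply]
  apply Finset.sum_congr rfl
  intro k _
  rw [(hc.pow_pow k (m - k)).eq, ← Nat.cast_comm]
  simp only [Module.End.mul_apply, hD, Rr, LinearMap.pow_mulRight, LinearMap.mulRight_apply,
    Module.End.natCast_apply, nsmul_eq_mul, Nat.cast_mul]
  simp [mul_assoc]

variable {p : ℕ} [hp : Fact p.Prime]

theorem pp_zero : (p : ZMod (p ^ 2)) * (p : ZMod (p ^ 2)) = 0 := by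
  have : ((p ^ 2 : ℕ) : ZMod (p ^ 2)) = 0 := ZMod.natCast_self _
  rw [← this]
  push_cast
  ring

theorem natCast_WA {R : Type} [CommRing R] (n : ℕ) : (n : WA R) = algebraMap R (WA R) (n : R) := by simp

def phi (p : ℕ) : ZMod (p ^ 2) →+* ZMod p := ZMod.castHom (Dvd.intro_left (p ^ 1) (by ring)) (ZMod p)

theorem phi_eq_zero {x : ZMod (p ^ 2)} (h : phi p x = 0) : ∃ y, x = (p : ZMod (p ^ 2)) * y := by
  have : NeZero (p ^ 2) := ⟨pow_ne_zero _ hp.out.ne_zero⟩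
  obtain ⟨n, rfl⟩ := ZMod.natCast_zmod_surjective x
  rw [map_natCast, ZMod.natCast_eq_zero_iff] at h
  obtain ⟨k, rfl⟩ := h
  exact ⟨k, by push_cast; ring⟩

theorem phi_of_mul {x : ZMod (p ^ 2)} (h : (p : ZMod (p ^ 2)) * x = 0) : phi p x = 0 := by
  have : NeZero (p ^ 2) := ⟨pow_ne_zero _ hp.out.ne_zero⟩
  obtain ⟨n, rfl⟩ := ZMod.natCast_zmod_surjective x
  rw [← Nat.cast_mul, ZMod.natCast_eq_zero_iff, pow_two] at h
  rw [map_natCast, ZMod.natCast_eq_zero_iff]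
  exact Nat.dvd_of_mul_dvd_mul_left hp.out.pos h

theorem phi_fact {x y : ZMod (p ^ 2)}
    (h : (p.factorial : ZMod (p ^ 2)) * x = (p.factorial : ZMod (p ^ 2)) * y) : phi p x = phi p y := by
  have h1 : (p : ZMod (p ^ 2)) * (((p - 1).factorial : ZMod (p ^ 2)) * (x - y)) = 0 := by
    rw [← mul_assoc, ← Nat.cast_mul, Nat.mul_factorial_pred hp.out.ne_zero, mul_sub, h, sub_self]
  have h2 := phi_of_mul h1
  rw [map_mul, map_natCast, mul_eq_zero, map_sub, sub_eq_zero] at h2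
  rcases h2 with h2 | h2
  · rw [ZMod.natCast_eq_zero_iff, hp.out.dvd_factorial] at h2
    have := hp.out.pos
    omega
  · exact h2

theorem comm_fact {A : Type} [Ring A] (hA : (p : A) * (p : A) = 0) {P Q : A} (h : Q * P = P * Q + 1) :
    Q ^ p * P ^ p = P ^ p * Q ^ p + (p.factorial : A) := by
  rw [gen_pow_pow h, Finset.sum_range_succ, Finset.sum_eq_single 0]
  · simp [Nat.descFactorial_self]
  · intro k hk hk0
    have hk' : k < p := by simpa using hk
    obtain ⟨c, hc⟩ := hp.out.dvd_choose_self hk0 hk'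
    have : p ∣ p.descFactorial k := by
      obtain ⟨k, rfl⟩ := Nat.exists_eq_succ_of_ne_zero hk0
      have : p.descFactorial (k + 1) = p * (p - 1).descFactorial k := by
        obtain ⟨q, hq⟩ := Nat.exists_eq_succ_of_ne_zero hp.out.ne_zero
        rw [hq, Nat.succ_descFactorial_succ]
        rfl
      exact Dvd.intro _ this.symm
    obtain ⟨d, hd⟩ := this
    rw [hc, hd, show p * c * (p * d) = (p * p) * (c * d) by ring, Nat.cast_mul, Nat.cast_mul p p, hA]
    simp
  · intro h0
    simp [hp.out.ne_zero] at h0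

theorem WA_pp : (p : WA (ZMod (p ^ 2))) * (p : WA (ZMod (p ^ 2))) = 0 := by
  rw [natCast_WA, ← map_mul, pp_zero, map_zero]

theorem wmap_zero_exists {w : WA (ZMod (p ^ 2))} (h : wmap (phi p) w = 0) :
    ∃ U, w = (p : WA (ZMod (p ^ 2))) * U := by
  have h1 : ∀ I, ∃ y, co w I = (p : ZMod (p ^ 2)) * y := by
    intro I
    apply phi_eq_zero
    rw [← co_wmap, h]
    simp
  choose y hy using h1
  refine ⟨∑ I ∈ (co w).support, y I • mo _ I, ?_⟩
  conv_lhs => rw [sum_mo w]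
  rw [Finset.mul_sum]
  apply Finset.sum_congr rfl
  intro I _
  rw [hy, natCast_WA, ← Algebra.smul_def, smul_smul]

theorem wmap_zero_mul {w : WA (ZMod (p ^ 2))} (h : wmap (phi p) w = 0) :
    (p : WA (ZMod (p ^ 2))) * w = 0 := by
  obtain ⟨U, rfl⟩ := wmap_zero_exists h
  rw [← mul_assoc, WA_pp, zero_mul]

theorem comm_pU {C U : WA (ZMod (p ^ 2))} (hC : ∀ v, wmap (phi p) C * v = v * wmap (phi p) C) :
    C * ((p : WA (ZMod (p ^ 2))) * U) = (p : WA (ZMod (p ^ 2))) * U * C := by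
  have h : (p : WA (ZMod (p ^ 2))) * (C * U - U * C) = 0 := by
    apply wmap_zero_mul
    rw [map_sub, map_mul, map_mul, hC, sub_self]
  rw [mul_sub, sub_eq_zero] at h
  rw [← mul_assoc, ← (Nat.cast_commute p C).eq, mul_assoc, h, mul_assoc]

theorem st_comm {A : Type} [Ring A] {s t e : A} (h : t * s = s * t + e) (hs : e * s = s * e)
    (ht : e * t = t * e) (he : e * e = 0) (j k : ℕ) :
    t ^ j * s ^ k = s ^ k * t ^ j + ((j * k : ℕ) : A) * (e * (s ^ (k - 1) * t ^ (j - 1))) := by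
  have h1 : ∀ k : ℕ, t * s ^ k = s ^ k * t + (k : A) * (e * s ^ (k - 1)) := by
    intro k
    induction k with
    | zero => simp
    | succ k ih =>
      rw [pow_succ', ← mul_assoc, h, add_mul, mul_assoc, ih, mul_add, ← mul_assoc s, ← mul_assoc s (k : A),
        (Nat.cast_commute k s).symm.eq, mul_assoc (k : A) s, ← mul_assoc s e, ← hs, mul_assoc e s]
      rcases k with _ | k
      · simp
      · simp only [Nat.add_sub_cancel, ← pow_succ', Nat.cast_add, Nat.cast_one]
        noncomm_ring
  induction j with
  | zero => simp
  | succ j ih =>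
    rw [pow_succ', mul_assoc, ih, mul_add, ← mul_assoc t (s ^ k), h1, add_mul]
    have h2 : t * (((j * k : ℕ) : A) * (e * (s ^ (k - 1) * t ^ (j - 1)))) =
        ((j * k : ℕ) : A) * (e * (s ^ (k - 1) * t ^ j)) := by
      rw [← mul_assoc, ← (Nat.cast_commute _ t).eq, mul_assoc, ← mul_assoc t e, ← ht, mul_assoc e t,
        ← mul_assoc t, h1, add_mul, mul_add, mul_assoc (((k - 1 : ℕ) : A)), mul_assoc e (s ^ (k - 1 - 1)),
        ← mul_assoc e (((k - 1 : ℕ) : A)), ← (Nat.cast_commute _ e).eq, mul_assoc _ e, ← mul_assoc e e, he]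
      rcases j with _ | j
      · simp
      · simp [mul_assoc, pow_succ']
    rw [h2, Nat.add_sub_cancel]
    push_cast
    rw [add_mul, one_mul, add_mul]
    simp only [mul_assoc]
    rw [add_assoc, add_comm ((k : A) * _)]

theorem mo_comm (i j k l : ℕ) :
    mo (ZMod (p ^ 2)) (p * i, p * j) * mo (ZMod (p ^ 2)) (p * k, p * l) -
      mo (ZMod (p ^ 2)) (p * k, p * l) * mo (ZMod (p ^ 2)) (p * i, p * j) =
    ((p.factorial : ZMod (p ^ 2)) * ((j : ZMod (p ^ 2)) * k - i * l)) •
      mo (ZMod (p ^ 2)) (p * (i + k - 1), p * (j + l - 1)) := by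
  have h1 := comm_fact (p := p) WA_pp (W_rel (R := ZMod (p ^ 2)))
  have he : (p.factorial : WA (ZMod (p ^ 2))) * (p.factorial : WA (ZMod (p ^ 2))) = 0 := by
    rw [← Nat.mul_factorial_pred hp.out.ne_zero, Nat.cast_mul, mul_assoc,
      (Nat.cast_commute (p - 1).factorial _).eq, mul_assoc, ← mul_assoc, WA_pp, zero_mul]
  have key : ∀ i j k l : ℕ, mo (ZMod (p ^ 2)) (p * i, p * j) * mo (ZMod (p ^ 2)) (p * k, p * l) =
      mo (ZMod (p ^ 2)) (p * (i + k), p * (j + l)) + ((p.factorial : ZMod (p ^ 2)) * (j * k)) •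
        mo (ZMod (p ^ 2)) (p * (i + k - 1), p * (j + l - 1)) := by
    intro i j k l
    have h2 := st_comm h1 (Nat.cast_commute _ _).eq (Nat.cast_commute _ _).eq he j k
    simp only [mo, pow_mul]
    generalize wx (ZMod (p ^ 2)) ^ p = s at *
    generalize wy (ZMod (p ^ 2)) ^ p = t at *
    rw [mul_assoc, ← mul_assoc (t ^ j), h2, add_mul, mul_add, Algebra.smul_def]
    congr 1
    · rw [pow_add, pow_add]; simp only [mul_assoc]
    · rcases j with _ | j
      · simp
      rcases k with _ | k
      · simp
      rw [show i + (k + 1) - 1 = i + k by omega, show j + 1 + l - 1 = j + l by omega]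
      simp only [Nat.add_sub_cancel, map_mul, map_natCast, ← Nat.cast_mul]
      rw [← mul_assoc _ (p.factorial : WA (ZMod (p ^ 2))), ← Nat.cast_mul, mul_assoc, ← mul_assoc (s ^ i),
        ← (Nat.cast_commute _ (s ^ i)).eq, pow_add, pow_add, mul_comm ((j + 1) * (k + 1))]
      simp only [mul_assoc]
  rw [key i j k l, key k l i j, add_comm k i, add_comm l j, add_sub_add_left_eq_sub, ← sub_smul]
  congr 1
  ring

end WeylFour

section WeylFive

variable {p : ℕ} [hp : Fact p.Prime]

def aa (P : WA (ZMod p)) (I : ℕ × ℕ) : ZMod p := co (P ^ p) (p * I.1, p * I.2)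

theorem aa_deg {P : WA (ZMod p)} {N : ℕ} (hP : ∀ I, co P I ≠ 0 → I.1 + I.2 ≤ N) (I : ℕ × ℕ)
    (h : aa P I ≠ 0) : I.1 + I.2 ≤ N := by
  have := deg_pow hP p _ h
  simp only at this
  rw [← mul_add] at this
  exact Nat.le_of_mul_le_mul_left this hp.out.pos

def Phi (N : ℕ) (w : WA (ZMod (p ^ 2))) : WA (ZMod (p ^ 2)) :=
  ∑ I ∈ Finset.range (N + 1) ×ˢ Finset.range (N + 1), co (w ^ p) (p * I.1, p * I.2) •
    mo (ZMod (p ^ 2)) (p * I.1, p * I.2)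

theorem wmap_Phi {N : ℕ} {w : WA (ZMod (p ^ 2))}
    (hw : ∀ I, co (wmap (phi p) w) I ≠ 0 → I.1 + I.2 ≤ N)
    (hc : ∀ v, wmap (phi p) w ^ p * v = v * wmap (phi p) w ^ p) :
    wmap (phi p) (Phi N w) = wmap (phi p) w ^ p := by
  apply co_inj
  rintro ⟨c, d⟩
  rw [Phi, map_sum, map_sum, Finsupp.finsetSum_apply]
  simp only [wmap_smul, wmap_mo, map_smul, Finsupp.smul_apply, co_mo, ← co_wmap, map_pow]
  by_cases h0 : co (wmap (phi p) w ^ p) (c, d) = 0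
  · rw [h0]
    apply Finset.sum_eq_zero
    rintro ⟨i, j⟩ _
    simp only [Finsupp.single_apply]
    split_ifs with h
    · rw [h, h0]; simp
    · simp
  · obtain ⟨⟨i, hi⟩, ⟨j, hj⟩⟩ := central_support hc _ h0
    simp only at hi hj
    subst hi hj
    have := aa_deg hw (i, j) h0
    simp only at this
    rw [Finset.sum_eq_single (i, j)]
    · simp
    · rintro ⟨i', j'⟩ _ hne
      rw [Finsupp.single_apply, if_neg]
      · simp
      · intro he
        apply hne
        simp only [Prod.mk.injEq, mul_eq_mul_left_iff, hp.out.ne_zero, or_false] at he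
        exact Prod.ext he.1 he.2
    · intro h
      simp at h
      omega

theorem jac {P Q : WA (ZMod (p ^ 2))} (h : Q * P = P * Q + 1) (N : ℕ)
    (hP : ∀ I, co (wmap (phi p) P) I ≠ 0 → I.1 + I.2 ≤ N)
    (hQ : ∀ I, co (wmap (phi p) Q) I ≠ 0 → I.1 + I.2 ≤ N) (m n : ℕ) :
    ∑ I ∈ Finset.range (N + 1) ×ˢ Finset.range (N + 1),
      ∑ J ∈ Finset.range (N + 1) ×ˢ Finset.range (N + 1),
        (if I.1 + J.1 = m + 1 ∧ I.2 + J.2 = n + 1 then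
          ((I.2 : ZMod p) * J.1 - I.1 * J.2) * (aa (wmap (phi p) Q) I * aa (wmap (phi p) P) J) else 0) =
      if m = 0 ∧ n = 0 then 1 else 0 := by
  have h' : wmap (phi p) Q * wmap (phi p) P = wmap (phi p) P * wmap (phi p) Q + 1 := by
    rw [← map_mul, h, map_add, map_mul, map_one]
  have hcP := Pp_central h'
  have hcQ := Qp_central h'
  have hmP := wmap_Phi hP hcP
  have hmQ := wmap_Phi hQ hcQ
  obtain ⟨U, hU⟩ := wmap_zero_exists (w := P ^ p - Phi N P) (by rw [map_sub, hmP, map_pow, sub_self])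
  obtain ⟨V, hV⟩ := wmap_zero_exists (w := Q ^ p - Phi N Q) (by rw [map_sub, hmQ, map_pow, sub_self])
  have eP : P ^ p = Phi N P + p * U := by rw [← hU]; abel
  have eQ : Q ^ p = Phi N Q + p * V := by rw [← hV]; abel
  have c1 := comm_pU (C := Phi N P) (U := V) (by rw [hmP]; exact hcP)
  have c2 := comm_pU (C := Phi N Q) (U := U) (by rw [hmQ]; exact hcQ)
  have c3 : ∀ U V : WA (ZMod (p ^ 2)), (p : WA (ZMod (p ^ 2))) * V * ((p : WA (ZMod (p ^ 2))) * U) = 0 := by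
    intro U V
    rw [mul_assoc, ← mul_assoc V, ← (Nat.cast_commute p V).eq, mul_assoc, ← mul_assoc, WA_pp, zero_mul]
  have h1 := comm_fact (p := p) WA_pp h
  have h2 : Phi N Q * Phi N P - Phi N P * Phi N Q = (p.factorial : WA (ZMod (p ^ 2))) := by
    rw [eP, eQ, add_mul, add_mul, mul_add, mul_add, mul_add, mul_add, c3, c3, ← c1, c2] at h1
    rw [sub_eq_iff_eq_add]
    have h3 := congrArg (fun x => x - ((p : WA (ZMod (p ^ 2))) * U * Phi N Q + Phi N P * ((p : WA (ZMod (p ^ 2))) * V))) h1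
    refine Eq.trans ?_ (h3.trans ?_)
    · abel
    · abel
  have h4 := congrArg (fun w => co w (p * m, p * n)) h2
  have h8 : Phi N Q * Phi N P - Phi N P * Phi N Q =
      ∑ I ∈ Finset.range (N + 1) ×ˢ Finset.range (N + 1),
      ∑ J ∈ Finset.range (N + 1) ×ˢ Finset.range (N + 1),
      ((co (Q ^ p) (p * I.1, p * I.2) • mo (ZMod (p ^ 2)) (p * I.1, p * I.2)) *
        (co (P ^ p) (p * J.1, p * J.2) • mo (ZMod (p ^ 2)) (p * J.1, p * J.2)) -
      (co (P ^ p) (p * J.1, p * J.2) • mo (ZMod (p ^ 2)) (p * J.1, p * J.2)) *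
        (co (Q ^ p) (p * I.1, p * I.2) • mo (ZMod (p ^ 2)) (p * I.1, p * I.2))) := by
    simp only [Finset.sum_sub_distrib]
    rw [Phi, Phi, Finset.sum_mul_sum, Finset.sum_mul_sum]
    congr 1
    exact Finset.sum_comm
  rw [h8] at h4
  beta_reduce at h4
  have h5 : ∀ I J : ℕ × ℕ, co ((co (Q ^ p) (p * I.1, p * I.2) • mo (ZMod (p ^ 2)) (p * I.1, p * I.2)) *
        (co (P ^ p) (p * J.1, p * J.2) • mo (ZMod (p ^ 2)) (p * J.1, p * J.2)) -
      (co (P ^ p) (p * J.1, p * J.2) • mo (ZMod (p ^ 2)) (p * J.1, p * J.2)) *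
        (co (Q ^ p) (p * I.1, p * I.2) • mo (ZMod (p ^ 2)) (p * I.1, p * I.2))) (p * m, p * n) =
      (p.factorial : ZMod (p ^ 2)) * (if I.1 + J.1 = m + 1 ∧ I.2 + J.2 = n + 1 then
        ((I.2 : ZMod (p ^ 2)) * J.1 - I.1 * J.2) * (co (Q ^ p) (p * I.1, p * I.2) *
          co (P ^ p) (p * J.1, p * J.2)) else 0) := by
    intro I J
    rw [smul_mul_smul_comm, smul_mul_smul_comm, mul_comm (co (P ^ p) _), ← smul_sub, mo_comm]
    rw [map_smul, map_smul, co_mo]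
    simp only [Finsupp.smul_apply, smul_eq_mul, Finsupp.single_apply, Prod.mk.injEq,
      mul_eq_mul_left_iff, hp.out.ne_zero, or_false]
    by_cases z1 : I.1 + J.1 = 0
    · have : I.1 = 0 := by omega
      have : J.1 = 0 := by omega
      simp [*]
    by_cases z2 : I.2 + J.2 = 0
    · have : I.2 = 0 := by omega
      have : J.2 = 0 := by omega
      simp [*]
    have e1 : (I.1 + J.1 - 1 = m) ↔ (I.1 + J.1 = m + 1) := by omega
    have e2 : (I.2 + J.2 - 1 = n) ↔ (I.2 + J.2 = n + 1) := by omega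
    simp only [e1, e2]
    split_ifs
    · ring
    · simp
  simp only [map_sum, Finsupp.finsetSum_apply, h5, ← Finset.mul_sum] at h4
  have h6 : co (p.factorial : WA (ZMod (p ^ 2))) (p * m, p * n) =
      (p.factorial : ZMod (p ^ 2)) * (if m = 0 ∧ n = 0 then 1 else 0) := by
    rw [natCast_WA, Algebra.algebraMap_eq_smul_one, map_smul, Finsupp.smul_apply, co_one, smul_eq_mul]
    simp [hp.out.ne_zero]
  rw [h6] at h4
  have h7 := phi_fact h4
  simp only [map_sum, apply_ite (phi p), map_mul, map_sub, map_natCast, map_zero, map_one, ← co_wmap,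
    map_pow] at h7
  exact h7

end WeylFive

section Newton

variable {p : ℕ} [hp : Fact p.Prime]

theorem newton_unique {a b : ℕ × ℕ → ZMod p} {T : Finset (ℕ × ℕ)} {r : ZMod p} {m n : ℕ}
    (H : ∑ I ∈ T, ∑ J ∈ T, (if I.1 + J.1 = m + 1 ∧ I.2 + J.2 = n + 1 then
          ((I.2 : ZMod p) * J.1 - I.1 * J.2) * (b I * a J) else 0) = r)
    (ha : ∀ I, a I ≠ 0 → I ∈ T) (hb : ∀ I, b I ≠ 0 → I ∈ T)
    (i j k l : ℕ) (h1 : i + k = m + 1) (h2 : j + l = n + 1)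
    (hu : ∀ i' j' k' l', b (i', j') ≠ 0 → a (k', l') ≠ 0 → i' + k' = m + 1 → j' + l' = n + 1 →
      (j' : ZMod p) * k' - i' * l' ≠ 0 → i' = i ∧ j' = j ∧ k' = k ∧ l' = l) :
    ((j : ZMod p) * k - i * l) * (b (i, j) * a (k, l)) = r := by
  have hz : ∀ I J, (I ≠ (i, j) ∨ J ≠ (k, l)) → (if I.1 + J.1 = m + 1 ∧ I.2 + J.2 = n + 1 then
          ((I.2 : ZMod p) * J.1 - I.1 * J.2) * (b I * a J) else 0) = 0 := by
    rintro ⟨i', j'⟩ ⟨k', l'⟩ hne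
    by_contra h
    split_ifs at h with hc
    · have c1 := left_ne_zero_of_mul h
      have c2 := right_ne_zero_of_mul h
      obtain ⟨rfl, rfl, rfl, rfl⟩ := hu i' j' k' l' (left_ne_zero_of_mul c2) (right_ne_zero_of_mul c2)
        hc.1 hc.2 c1
      simp at hne
    · exact h rfl
  rw [← H, Finset.sum_eq_single (i, j), Finset.sum_eq_single (k, l)]
  · rw [if_pos ⟨h1, h2⟩]
  · intro J _ hne
    exact hz _ _ (Or.inr hne)
  · intro hn
    have : a (k, l) = 0 := by
      by_contra h; exact hn (ha _ h)
    simp [this]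
  · intro I _ hne
    exact Finset.sum_eq_zero fun J _ => hz _ _ (Or.inl hne)
  · intro hn
    have : b (i, j) = 0 := by
      by_contra h; exact hn (hb _ h)
    simp [this]

theorem natCast_ne {c : ℕ} (h0 : 0 < c) (h1 : c < p) : (c : ZMod p) ≠ 0 := by
  intro h
  rw [ZMod.natCast_eq_zero_iff] at h
  exact absurd (Nat.le_of_dvd h0 h) (by omega)

theorem newton {a b : ℕ × ℕ → ZMod p} {N : ℕ} (hN : N * N < p) (hN1 : N < p)
    (ha : ∀ I, a I ≠ 0 → I.1 + I.2 ≤ N) (hb : ∀ I, b I ≠ 0 → I.1 + I.2 ≤ N)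
    (hb0 : ∀ i, b (i, 0) = 0)
    (H : ∀ m n, ∑ I ∈ Finset.range (N + 1) ×ˢ Finset.range (N + 1),
      ∑ J ∈ Finset.range (N + 1) ×ˢ Finset.range (N + 1),
        (if I.1 + J.1 = m + 1 ∧ I.2 + J.2 = n + 1 then
          ((I.2 : ZMod p) * J.1 - I.1 * J.2) * (b I * a J) else 0) =
      if m = 0 ∧ n = 0 then 1 else 0) :
    ∀ I, b I ≠ 0 → I = (0, 1) := by
  set T := Finset.range (N + 1) ×ˢ Finset.range (N + 1) with hT
  have haT : ∀ I, a I ≠ 0 → I ∈ T := by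
    intro I h
    have := ha I h
    simp [hT]; omega
  have hbT : ∀ I, b I ≠ 0 → I ∈ T := by
    intro I h
    have := hb I h
    simp [hT]; omega
  have hbj : ∀ i j, b (i, j) ≠ 0 → 1 ≤ j := by
    intro i j h
    rcases j with _ | j
    · exact absurd (hb0 i) h
    · omega
  -- step one
  have s0 := newton_unique (H 0 0) haT hbT 0 1 1 0 rfl rfl (by
    intro i' j' k' l' h1 h2 h3 h4 h5
    have := hbj _ _ h1
    have e1 : j' = 1 := by omega
    have e2 : l' = 0 := by omega
    have e3 : k' ≠ 0 := by
      rintro rfl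
      simp [e2] at h5
    omega)
  simp at s0
  have b01 : b (0, 1) ≠ 0 := left_ne_zero_of_mul (s0 ▸ one_ne_zero)
  have a10 : a (1, 0) ≠ 0 := right_ne_zero_of_mul (s0 ▸ one_ne_zero)
  obtain ⟨⟨i1, j1⟩, hI1, hI1m⟩ := Finset.exists_max_image (T.filter (fun I => b I ≠ 0 ∧ I.2 = 1))
    (fun I => I.1) ⟨(0, 1), by simp [b01, hbT _ b01]⟩
  obtain ⟨⟨k1, l1⟩, hK1, hK1m⟩ := Finset.exists_max_image (T.filter (fun I => a I ≠ 0 ∧ I.2 = 0))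
    (fun I => I.1) ⟨(1, 0), by simp [a10, haT _ a10]⟩
  simp only [Finset.mem_filter] at hI1 hI1m hK1 hK1m
  obtain ⟨-, hI1, rfl⟩ := hI1
  obtain ⟨-, hK1, rfl⟩ := hK1
  have m1 : ∀ i, b (i, 1) ≠ 0 → i ≤ i1 := fun i h => hI1m (i, 1) ⟨hbT _ h, h, rfl⟩
  have m2 : ∀ k, a (k, 0) ≠ 0 → k ≤ k1 := fun k h => hK1m (k, 0) ⟨haT _ h, h, rfl⟩
  have k1pos := m2 1 a10
  have s1 := newton_unique (H (i1 + k1 - 1) 0) haT hbT i1 1 k1 0 (by omega) rfl (by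
    intro i' j' k' l' h1 h2 h3 h4 h5
    have := hbj _ _ h1
    have e1 : j' = 1 := by omega
    have e2 : l' = 0 := by omega
    subst e1 e2
    have := m1 _ h1
    have := m2 _ h2
    omega)
  have hk1N := ha _ hK1
  simp only at hk1N
  have s2 : i1 = 0 ∧ k1 = 1 := by
    by_contra hne
    rw [if_neg (by omega)] at s1
    simp only [Nat.cast_one, one_mul, Nat.cast_zero, mul_zero, sub_zero] at s1
    exact mul_ne_zero (natCast_ne (by omega) (by omega)) (mul_ne_zero hI1 hK1) s1
  obtain ⟨rfl, rfl⟩ := s2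
  -- slope
  let S : Finset (ℕ × ℕ) := {(0, 1)} ∪ (T.filter (fun I => a I ≠ 0 ∧ 1 ≤ I.2)).image (fun I => (I.1 - 1, I.2)) ∪
    (T.filter (fun I => b I ≠ 0 ∧ 2 ≤ I.2)).image (fun I => (I.1, I.2 - 1))
  obtain ⟨⟨u, v⟩, hS, hSm⟩ := Finset.exists_max_image S (fun x => (x.1 : ℚ) / x.2) ⟨(0, 1), by simp [S]⟩
  have hSpos : ∀ x ∈ S, 0 < x.2 := by
    intro x hx
    simp only [S, Finset.mem_union, Finset.mem_singleton, Finset.mem_image, Finset.mem_filter] at hx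
    rcases hx with (rfl | ⟨y, ⟨_, _, h⟩, rfl⟩) | ⟨y, ⟨_, _, h⟩, rfl⟩
    · simp
    · simp only; omega
    · simp only; omega
  have hv : 0 < v := hSpos _ hS
  have hle : ∀ x ∈ S, x.1 * v ≤ u * x.2 := by
    intro x hx
    have h1 := hSm x hx
    have h2 := hSpos x hx
    simp only at h1
    rw [div_le_div_iff₀ (by exact_mod_cast h2) (by exact_mod_cast hv)] at h1
    exact_mod_cast h1
  have lea : ∀ k l, a (k, l) ≠ 0 → v * k ≤ u * l + v := by
    intro k l h
    rcases Nat.eq_zero_or_pos l with rfl | hl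
    · have := m2 k h
      nlinarith
    · have := hle (k - 1, l) (by
        simp only [S, Finset.mem_union, Finset.mem_image, Finset.mem_filter]
        exact Or.inl (Or.inr ⟨(k, l), ⟨haT _ h, h, hl⟩, rfl⟩))
      simp only at this
      have h3 : k ≤ (k - 1) + 1 := by omega
      nlinarith
  have leb : ∀ i j, b (i, j) ≠ 0 → v * i + u ≤ u * j := by
    intro i j h
    have := hbj _ _ h
    rcases Nat.lt_or_ge j 2 with hj | hj
    · have e : j = 1 := by omega
      subst e
      have := m1 i h
      nlinarith
    · have := hle (i, j - 1) (by
        simp only [S, Finset.mem_union, Finset.mem_image, Finset.mem_filter]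
        exact Or.inr ⟨(i, j), ⟨hbT _ h, h, hj⟩, rfl⟩)
      simp only at this
      obtain ⟨j, rfl⟩ := Nat.exists_eq_add_of_le' hj
      simp at this
      nlinarith
  have att : u = 0 ∨ (∃ k l, a (k, l) ≠ 0 ∧ 1 ≤ l ∧ v * k = u * l + v) ∨
      (∃ i j, b (i, j) ≠ 0 ∧ 2 ≤ j ∧ v * i + u = u * j) := by
    rcases Nat.eq_zero_or_pos u with h0 | h0
    · exact Or.inl h0
    · right
      simp only [S, Finset.mem_union, Finset.mem_singleton, Finset.mem_image, Finset.mem_filter] at hS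
      rcases hS with (h | ⟨⟨k, l⟩, ⟨_, h1, h2⟩, h3⟩) | ⟨⟨i, j⟩, ⟨_, h1, h2⟩, h3⟩
      · simp at h; omega
      · left
        simp only [Prod.mk.injEq] at h3
        refine ⟨k, l, h1, h2, ?_⟩
        obtain ⟨rfl, rfl⟩ := h3
        have : k = k - 1 + 1 := by omega
        conv_lhs => rw [this]
        ring
      · right
        simp only [Prod.mk.injEq] at h3
        refine ⟨i, j, h1, h2, ?_⟩
        obtain ⟨rfl, rfl⟩ := h3
        simp only at h2
        obtain ⟨j, rfl⟩ := Nat.exists_eq_add_of_le' h2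
        simp
        ring
  obtain ⟨⟨k0, l0⟩, hK0, hK0m⟩ := Finset.exists_max_image (T.filter (fun I => a I ≠ 0 ∧ v * I.1 = u * I.2 + v))
    (fun I => I.2) ⟨(1, 0), by simp [a10, haT _ a10]⟩
  obtain ⟨⟨i0, j0⟩, hI0, hI0m⟩ := Finset.exists_max_image (T.filter (fun I => b I ≠ 0 ∧ v * I.1 + u = u * I.2))
    (fun I => I.2) ⟨(0, 1), by simp [b01, hbT _ b01]⟩
  simp only [Finset.mem_filter] at hI0 hI0m hK0 hK0m
  obtain ⟨-, hI0, eI⟩ := hI0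
  obtain ⟨-, hK0, eK⟩ := hK0
  have M1 : ∀ i j, b (i, j) ≠ 0 → v * i + u = u * j → j ≤ j0 := fun i j h h' => hI0m (i, j) ⟨hbT _ h, h, h'⟩
  have M2 : ∀ k l, a (k, l) ≠ 0 → v * k = u * l + v → l ≤ l0 := fun k l h h' => hK0m (k, l) ⟨haT _ h, h, h'⟩
  have j0pos := hbj _ _ hI0
  have k0pos : 1 ≤ k0 := by
    rcases Nat.eq_zero_or_pos k0 with rfl | h
    · simp at eK; omega
    · exact h
  have s3 := newton_unique (H (i0 + k0 - 1) (j0 + l0 - 1)) haT hbT i0 j0 k0 l0 (by omega) (by omega) (by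
    intro i' j' k' l' h1 h2 h3 h4 _
    have q1 := lea _ _ h2
    have q2 := leb _ _ h1
    have q3 : i' + k' = i0 + k0 := by omega
    have q4 : j' + l' = j0 + l0 := by omega
    have q5 : v * i' + v * k' = v * i0 + v * k0 := by rw [← mul_add, q3, mul_add]
    have q6 : u * j' + u * l' = u * j0 + u * l0 := by rw [← mul_add, q4, mul_add]
    have r1 : v * i' + u = u * j' := by omega
    have r2 : v * k' = u * l' + v := by omega
    have := M1 _ _ h1 r1
    have := M2 _ _ h2 r2
    have e1 : j' = j0 := by omega
    have e2 : l' = l0 := by omega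
    subst e1 e2
    have : v * i' = v * i0 := by omega
    have e3 := Nat.eq_of_mul_eq_mul_left hv this
    omega)
  have hc : v * (j0 * k0) = v * (i0 * l0) + (v * j0 + u * l0) := by
    have x1 : j0 * (v * k0) = j0 * (u * l0 + v) := by rw [eK]
    have x2 : l0 * (v * i0 + u) = l0 * (u * j0) := by rw [eI]
    nlinarith
  have hlt : i0 * l0 < j0 * k0 := by
    have : 0 < v * j0 := Nat.mul_pos hv j0pos
    have : v * (i0 * l0) < v * (j0 * k0) := by omega
    exact Nat.lt_of_mul_lt_mul_left this
  have hbd : j0 * k0 ≤ N * N := by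
    have z1 := hb _ hI0
    have z2 := ha _ hK0
    simp only at z1 z2
    exact Nat.mul_le_mul (by omega) (by omega)
  have hcne : (j0 : ZMod p) * k0 - i0 * l0 ≠ 0 := by
    have := natCast_ne (p := p) (c := j0 * k0 - i0 * l0) (by omega) (by omega)
    rw [Nat.cast_sub hlt.le] at this
    push_cast at this
    exact this
  have s4 : i0 + k0 - 1 = 0 ∧ j0 + l0 - 1 = 0 := by
    by_contra hne
    rw [if_neg hne] at s3
    exact mul_ne_zero hcne (mul_ne_zero hI0 hK0) s3
  have hu0 : u = 0 := by
    rcases att with h | ⟨k, l, h1, h2, h3⟩ | ⟨i, j, h1, h2, h3⟩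
    · exact h
    · have := M2 _ _ h1 h3
      omega
    · have := M1 _ _ h1 h3
      omega
  rintro ⟨i, j⟩ h
  have q1 := leb _ _ h
  subst hu0
  have q2 : v * i = 0 := by simpa using q1
  have q3 : i = 0 := by
    rcases Nat.mul_eq_zero.mp q2 with h | h
    · omega
    · exact h
  subst q3
  have := M1 _ _ h (by simp)
  have := hbj _ _ h
  ext
  · rfl
  · simp only; omega

end Newton

section WeylSeven

variable {p : ℕ} [hp : Fact p.Prime]

theorem modp {P Q : WA (ZMod (p ^ 2))} (h : Q * P = P * Q + 1) (N : ℕ) (h2 : 2 < p)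
    (hN : N * N < p) (hN1 : N < p)
    (hP : ∀ I, co (wmap (phi p) P) I ≠ 0 → I.1 + I.2 ≤ N)
    (hQ : ∀ I, co (wmap (phi p) Q) I ≠ 0 → I.1 + I.2 ≤ N) (hst : st Q = -Q) (I : ℕ × ℕ)
    (hI : co (wmap (phi p) Q) I ≠ 0) : I = (0, 0) ∨ I = (0, 1) := by
  have h' : wmap (phi p) Q * wmap (phi p) P = wmap (phi p) P * wmap (phi p) Q + 1 := by
    rw [← map_mul, h, map_add, map_mul, map_one]
  have hodd : Odd p := hp.out.odd_of_ne_two (by omega)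
  have hstQ : st (wmap (phi p) Q ^ p) = - wmap (phi p) Q ^ p := by
    rw [st_pow, ← wmap_st, hst, map_neg, hodd.neg_pow]
  have h20 : (2 : ZMod p) ≠ 0 := by exact_mod_cast natCast_ne (p := p) (c := 2) (by omega) h2
  have key := newton hN hN1 (aa_deg hP) (aa_deg hQ) (by
    intro i
    exact st_central (Qp_central h') h20 hstQ _) (jac h N hP hQ)
  have hne : wmap (phi p) Q ≠ 0 := by
    intro h0
    rw [h0] at hI
    simp at hI
  obtain ⟨I0, c0, l0⟩ := exists_lead hne N (fun I h => by have := hQ I h; omega)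
  have hpow := (l0.pow (by omega) p).2
  have e0 : I0 = (0, 1) := by
    apply key
    rw [aa, show (p * I0.1, p * I0.2) = p • I0 from rfl, hpow]
    exact pow_ne_zero _ c0
  subst e0
  by_cases hI0 : I = (0, 1)
  · exact Or.inr hI0
  · left
    have := l0 I hI hI0
    obtain ⟨i, j⟩ := I
    simp only [mul_zero, zero_add, mul_one, one_mul] at this
    have h3 : (N + 1) * i = 0 := by omega
    simp at h3
    ext
    · exact h3
    · simp only; omega

end WeylSeven

theorem prime_val (g : Polynomial ℤ) (hg : 0 < g.natDegree) (M : ℕ) :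
    ∃ p : ℕ, p.Prime ∧ M < p ∧ ∃ n : ℤ, (p : ℤ) ∣ g.eval n := by
  by_cases hc : g.eval 0 = 0
  · obtain ⟨p, hp, hp'⟩ := Nat.exists_infinite_primes (M+1)
    exact ⟨p, hp', by omega, 0, by rw [hc]; exact dvd_zero _⟩
  set c := g.eval 0 with hcdef
  have ne1 : ∀ d : ℤ, g - Polynomial.C d ≠ 0 := by
    intro d h
    have : g = Polynomial.C d := by linear_combination h
    rw [this] at hg; simp at hg
  have hM : (M.factorial : ℤ) ≠ 0 := by exact_mod_cast M.factorial_ne_zero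
  have : ∃ k : ℤ, g.eval (c * M.factorial * k) ≠ c ∧ g.eval (c * M.factorial * k) ≠ -c := by
    by_contra! hcon
    have hinf : (Set.range (fun k : ℤ => c * M.factorial * k)).Infinite := by
      apply Set.infinite_range_of_injective
      intro a b h
      exact mul_left_cancel₀ (mul_ne_zero hc hM) h
    have hz : (g - Polynomial.C c) * (g - Polynomial.C (-c)) = 0 := by
      apply Polynomial.eq_zero_of_infinite_isRoot
      apply hinf.mono
      rintro _ ⟨k, rfl⟩
      simp only [Set.mem_ofPred_eq, Polynomial.IsRoot, Polynomial.eval_mul, Polynomial.eval_sub, Polynomial.eval_C]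
      by_cases h : g.eval (c * M.factorial * k) = c
      · rw [h]; simp
      · rw [hcon k h]; simp
    exact mul_ne_zero (ne1 _) (ne1 _) hz
  obtain ⟨k, h1, h2⟩ := this
  have hd : (c * M.factorial * k) - 0 ∣ g.eval (c * M.factorial * k) - g.eval 0 := Polynomial.sub_dvd_eval_sub _ _ _
  rw [sub_zero, ← hcdef] at hd
  obtain ⟨t, ht⟩ := hd
  have hv : g.eval (c * M.factorial * k) = c * (1 + M.factorial * k * t) := by linear_combination ht
  set u : ℤ := 1 + M.factorial * k * t with hu
  have hu1 : u.natAbs ≠ 1 := by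
    intro h
    rcases Int.natAbs_eq u with h' | h' <;> rw [h] at h'
    · apply h1; rw [hv, h']; simp
    · apply h2; rw [hv, h']; simp
  obtain ⟨p, hp, hpd⟩ := Nat.exists_prime_and_dvd hu1
  have hpu : (p : ℤ) ∣ u := Int.natCast_dvd.mpr hpd
  refine ⟨p, hp, ?_, _, by rw [hv]; exact Dvd.dvd.mul_left hpu c⟩
  by_contra! hle
  have h3 : (p : ℤ) ∣ M.factorial := by exact_mod_cast (hp.dvd_factorial.mpr hle)
  have h4 : (p : ℤ) ∣ 1 := by
    have := dvd_sub hpu ((h3.mul_right k).mul_right t)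
    rwa [hu, add_sub_cancel_right] at this
  have := Int.le_of_dvd one_pos h4
  have := hp.two_le
  omega

theorem clear_den (f : Polynomial ℚ) : ∃ D : ℤ, D ≠ 0 ∧ ∃ f' : Polynomial ℤ,
    f'.map (algebraMap ℤ ℚ) = Polynomial.C (D : ℚ) * f := by
  obtain ⟨b, hb, h⟩ := IsLocalization.integerNormalization_spec (nonZeroDivisors ℤ) f
  refine ⟨b, nonZeroDivisors.ne_zero hb, _, h.trans ?_⟩
  rw [← Int.cast_smul_eq_zsmul ℚ, Polynomial.smul_eq_C_mul]

theorem clear_elts {E : Type*} [Field E] [Algebra ℚ E] (α : E)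
    (s : Finset E) (hα : ∀ e : E, ∃ h : Polynomial ℚ, Polynomial.aeval α h = e) :
    ∃ D : ℤ, D ≠ 0 ∧ ∀ e ∈ s, ∃ h : Polynomial ℤ, Polynomial.aeval α h = (D : E) * e := by
  classical
  induction s using Finset.induction_on with
  | empty => exact ⟨1, one_ne_zero, by simp⟩
  | insert a s ha ih =>
    obtain ⟨D, hD, hs⟩ := ih
    obtain ⟨h, rfl⟩ := hα a
    obtain ⟨D', hD', f', hf'⟩ := clear_den h
    have hk : Polynomial.aeval α f' = (D' : E) * Polynomial.aeval α h := by
      rw [← Polynomial.aeval_map_algebraMap ℚ, hf']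
      simp
    refine ⟨D' * D, mul_ne_zero hD' hD, ?_⟩
    intro e he
    rcases Finset.mem_insert.mp he with rfl | he
    · exact ⟨Polynomial.C D * f', by simp [hk]; ring⟩
    · obtain ⟨h', hh'⟩ := hs e he
      exact ⟨Polynomial.C D' * h', by simp [hh']; ring⟩

theorem number_field_red (E : Type) [Field E] [Algebra ℚ E] [FiniteDimensional ℚ E] (s : Finset E) (N : ℕ) :
    ∃ p : ℕ, ∃ (_ : Fact p.Prime), N < p ∧ ∃ φ : E →+* ℚ_[p], ∀ e ∈ s, ‖φ e‖ ≤ 1 := by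
  obtain ⟨α, hα⟩ := Field.exists_primitive_element ℚ E
  have hint : IsIntegral ℚ α := Algebra.IsIntegral.isIntegral α
  have hsurj : ∀ e : E, ∃ h : Polynomial ℚ, Polynomial.aeval α h = e := by
    intro e
    have h1 : e ∈ IntermediateField.adjoin ℚ {α} := by rw [hα]; trivial
    have h2 : e ∈ (IntermediateField.adjoin ℚ {α}).toSubalgebra := h1
    rw [IntermediateField.adjoin_simple_toSubalgebra_of_isAlgebraic hint.isAlgebraic, Algebra.adjoin_singleton_eq_range_aeval] at h2
    exact h2
  obtain ⟨D, hD, hs⟩ := clear_elts α s hsurj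
  obtain ⟨D1, hD1, g, hg⟩ := clear_den (minpoly ℚ α)
  have hD1' : (D1 : ℚ) ≠ 0 := by exact_mod_cast hD1
  have hgd : 0 < g.natDegree := by
    rw [← Polynomial.natDegree_map_eq_of_injective (algebraMap ℤ ℚ).injective_int g, hg,
      Polynomial.natDegree_C_mul hD1']
    exact minpoly.natDegree_pos hint
  have hsep : (g.map (algebraMap ℤ ℚ)).Separable := by
    rw [hg]
    exact (minpoly.irreducible hint).separable.unit_mul (Polynomial.isUnit_C.mpr hD1'.isUnit)
  obtain ⟨a, b, hab⟩ := hsep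
  obtain ⟨D2, hD2, a', ha'⟩ := clear_den a
  obtain ⟨D3, hD3, b', hb'⟩ := clear_den b
  have hbez : Polynomial.C D3 * a' * g + Polynomial.C D2 * b' * Polynomial.derivative g = Polynomial.C (D2 * D3) := by
    apply Polynomial.map_injective (algebraMap ℤ ℚ) (algebraMap ℤ ℚ).injective_int
    simp only [Polynomial.map_add, Polynomial.map_mul, ha', hb', Polynomial.map_C, ← Polynomial.derivative_map]
    simp only [eq_intCast, Int.cast_mul, Polynomial.C_mul]
    linear_combination Polynomial.C (D2:ℚ) * Polynomial.C (D3:ℚ) * hab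
  obtain ⟨p, hp, hpM, n, hn⟩ := prime_val g hgd (N + (D * D2 * D3).natAbs)
  haveI : Fact p.Prime := ⟨hp⟩
  have hpD : ¬ (p : ℤ) ∣ D * D2 * D3 := by
    intro h
    have := Nat.le_of_dvd (Int.natAbs_pos.mpr (mul_ne_zero (mul_ne_zero hD hD2) hD3)) (Int.natCast_dvd.mp h)
    omega
  have hpr : Prime (p : ℤ) := Nat.prime_iff_prime_int.mp hp
  have hpd : ¬ (p : ℤ) ∣ (Polynomial.derivative g).eval n := by
    intro h
    apply hpD
    have := congrArg (Polynomial.eval n) hbez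
    simp only [Polynomial.eval_add, Polynomial.eval_mul, Polynomial.eval_C] at this
    rw [mul_assoc, ← this]
    exact Dvd.dvd.mul_left (dvd_add (hn.mul_left _) (h.mul_left _)) _
  have e1 : ∀ q : Polynomial ℤ, Polynomial.aeval (n : ℤ_[p]) q = ((q.eval n : ℤ) : ℤ_[p]) := by
    intro q
    have := Polynomial.aeval_algebraMap_apply ℤ_[p] n q
    simpa using this
  have n1 : ‖(((Polynomial.derivative g).eval n : ℤ) : ℤ_[p])‖ = 1 := by
    rcases (PadicInt.norm_le_one (((Polynomial.derivative g).eval n : ℤ) : ℤ_[p])).lt_or_eq with h | h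
    · exact absurd ((PadicInt.norm_int_lt_one_iff_dvd _).mp h) hpd
    · exact h
  obtain ⟨z, hz, -⟩ := hensels_lemma (p := p) (F := g) (a := (n : ℤ_[p])) (by
    rw [e1, e1, n1, one_pow]
    exact (PadicInt.norm_int_lt_one_iff_dvd _).mpr hn)
  have hzq : ∀ q : Polynomial ℤ, Polynomial.aeval (z : ℚ_[p]) q = ((Polynomial.aeval z q : ℤ_[p]) : ℚ_[p]) := by
    intro q
    exact Polynomial.aeval_algebraMap_apply ℚ_[p] z q
  have hroot : Polynomial.aeval (z : ℚ_[p]) (minpoly ℚ α) = 0 := by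
    have h1 : Polynomial.aeval (z : ℚ_[p]) (g.map (algebraMap ℤ ℚ)) = 0 := by
      rw [Polynomial.aeval_map_algebraMap, hzq, hz]; rfl
    rw [hg, map_mul, Polynomial.aeval_C] at h1
    rcases mul_eq_zero.mp h1 with h | h
    · exact absurd ((map_eq_zero _).mp h) hD1'
    · exact h
  let φ : E →+* ℚ_[p] := (Polynomial.aeval α : Polynomial ℚ →ₐ[ℚ] E).toRingHom.liftOfSurjective hsurj
    ⟨(Polynomial.aeval (z : ℚ_[p]) : Polynomial ℚ →ₐ[ℚ] ℚ_[p]).toRingHom, by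
      intro q hq
      have h1 : Polynomial.aeval α q = 0 := hq
      obtain ⟨r, rfl⟩ := minpoly.dvd ℚ α h1
      show Polynomial.aeval (z : ℚ_[p]) (minpoly ℚ α * r) = 0
      rw [map_mul, hroot, zero_mul]⟩
  have hφ : ∀ q : Polynomial ℚ, φ (Polynomial.aeval α q) = Polynomial.aeval (z : ℚ_[p]) q := by
    intro q
    exact RingHom.liftOfRightInverse_comp_apply _ _ _ _ _
  refine ⟨p, ⟨hp⟩, by omega, φ, ?_⟩
  intro e he
  obtain ⟨h, hh⟩ := hs e he
  have h3 : (D : ℚ_[p]) * φ e = ((Polynomial.aeval z h : ℤ_[p]) : ℚ_[p]) := by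
    have : φ (Polynomial.aeval α h) = Polynomial.aeval (z : ℚ_[p]) h := by
      rw [← Polynomial.aeval_map_algebraMap ℚ α, hφ, Polynomial.aeval_map_algebraMap]
    rw [← hzq, ← this, hh]; simp
  have h4 : ‖(D : ℚ_[p])‖ = 1 := by
    have hh : ‖((D : ℤ) : ℤ_[p])‖ = 1 := by
      rcases (PadicInt.norm_le_one ((D : ℤ) : ℤ_[p])).lt_or_eq with h | h
      · exact absurd ((((PadicInt.norm_int_lt_one_iff_dvd _).mp h).mul_right D2).mul_right D3) hpD
      · exact h
    rw [← hh, PadicInt.norm_def]; simp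
  have h5 : ‖φ e‖ = ‖(Polynomial.aeval z h : ℤ_[p])‖ := by
    rw [PadicInt.norm_def, ← h3, norm_mul, h4, one_mul]
  show ‖φ e‖ ≤ 1
  rw [h5]; exact PadicInt.norm_le_one _

theorem exists_field (A : Type) [CommRing A] [Nontrivial A] [Algebra ℚ A] [Algebra.FiniteType ℚ A] :
    ∃ (E : Type) (_ : Field E) (_ : Algebra ℚ E) (_ : FiniteDimensional ℚ E), Nonempty (A →+* E) := by
  obtain ⟨m, hm⟩ := Ideal.exists_maximal A
  letI := Ideal.Quotient.field m
  have h1 : Algebra.FiniteType ℚ (A ⧸ m) :=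
    Algebra.FiniteType.of_surjective (Ideal.Quotient.mkₐ ℚ m) (Ideal.Quotient.mkₐ_surjective ℚ m)
  have h2 : Module.Finite ℚ (A ⧸ m) := finite_of_finite_type_of_isJacobsonRing ℚ (A ⧸ m)
  exact ⟨A ⧸ m, inferInstance, inferInstance, h2, ⟨Ideal.Quotient.mk m⟩⟩

theorem reduction (K : Type) [Field K] [CharZero K] (s : Finset K) (N : ℕ) :
    ∃ p : ℕ, ∃ (_ : Fact p.Prime), N < p ∧
      Nonempty (Algebra.adjoin ℤ (s : Set K) →+* ZMod (p^2)) := by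
  classical
  let A := Algebra.adjoin ℚ (s : Set K)
  haveI : Algebra.FiniteType ℚ A := (Subalgebra.fg_iff_finiteType _).mp ⟨s, rfl⟩
  obtain ⟨E, _, _, _, ⟨π⟩⟩ := exists_field A
  let s' : Finset E := s.attach.image fun x => π ⟨x.1, Algebra.subset_adjoin x.2⟩
  obtain ⟨p, hp, hN, φ, hφ⟩ := number_field_red E s' N
  refine ⟨p, hp, hN, ?_⟩
  have hle : ∀ x ∈ Algebra.adjoin ℤ (s : Set K), ∃ hx : x ∈ A, ‖φ (π ⟨x, hx⟩)‖ ≤ 1 := by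
    intro x hx
    induction hx using Algebra.adjoin_induction with
    | mem x hx =>
      refine ⟨Algebra.subset_adjoin hx, hφ _ ?_⟩
      exact Finset.mem_image.mpr ⟨⟨x, hx⟩, Finset.mem_attach _ _, rfl⟩
    | algebraMap r =>
      refine ⟨by simp, ?_⟩
      have : (⟨algebraMap ℤ K r, by simp⟩ : A) = (r : A) := by ext; simp
      rw [this, map_intCast, map_intCast]
      exact Padic.norm_int_le_one r
    | add x y _ _ hx hy =>
      obtain ⟨hx, hx'⟩ := hx
      obtain ⟨hy, hy'⟩ := hy
      refine ⟨add_mem hx hy, ?_⟩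
      have : (⟨x + y, add_mem hx hy⟩ : A) = ⟨x, hx⟩ + ⟨y, hy⟩ := rfl
      rw [this, map_add, map_add]
      exact (Padic.nonarchimedean _ _).trans (max_le hx' hy')
    | mul x y _ _ hx hy =>
      obtain ⟨hx, hx'⟩ := hx
      obtain ⟨hy, hy'⟩ := hy
      refine ⟨mul_mem hx hy, ?_⟩
      have : (⟨x * y, mul_mem hx hy⟩ : A) = ⟨x, hx⟩ * ⟨y, hy⟩ := rfl
      rw [this, map_mul, map_mul, norm_mul]
      exact mul_le_one₀ hx' (norm_nonneg _) hy'
  let ι : Algebra.adjoin ℤ (s : Set K) →+* A :=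
    (Algebra.adjoin ℤ (s : Set K)).val.toRingHom.codRestrict A (fun x => (hle x.1 x.2).1)
  let θ : Algebra.adjoin ℤ (s : Set K) →+* ℚ_[p] := (φ.comp π).comp ι
  let θ' : Algebra.adjoin ℤ (s : Set K) →+* ℤ_[p] := θ.codRestrict (PadicInt.subring p) (fun x => (hle x.1 x.2).2)
  exact ⟨(PadicInt.toZModPow 2).comp θ'⟩

theorem exists_lift {R S : Type} [CommRing R] [CommRing S] (φ : R →+* S) (w : WA S)
    (h : ∀ I, co w I ∈ φ.range) : ∃ v : WA R, wmap φ v = w := by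
  choose c hc using h
  refine ⟨∑ I ∈ (co w).support, c I • mo R I, ?_⟩
  conv_rhs => rw [sum_mo w]
  rw [map_sum]
  refine Finset.sum_congr rfl fun I _ => ?_
  rw [wmap_smul, wmap_mo, hc]

theorem wmap_inj {R S : Type} [CommRing R] [CommRing S] {φ : R →+* S} (h : Function.Injective φ) :
    Function.Injective (wmap φ) := by
  intro a b hab
  apply co_inj
  intro I
  apply h
  rw [← co_wmap, ← co_wmap, hab]

theorem core0 {K : Type} [Field K] [CharZero K] {P Q : WA K} (h : Q * P = P * Q + 1)
    (hst : st Q = -Q) (I : ℕ × ℕ) (hI : co Q I ≠ 0) : I = (0,0) ∨ I = (0,1) := by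
  classical
  obtain ⟨M, hM⟩ := exists_bound P
  obtain ⟨M', hM'⟩ := exists_bound Q
  let s : Finset K := (co P).support.image (co P) ∪ (co Q).support.image (co Q) ∪ {(co Q I)⁻¹}
  let N := M + M'
  obtain ⟨p, hp, hN, ⟨ψ⟩⟩ := reduction K s (N * N + N + 2)
  let T := Algebra.adjoin ℤ (s : Set K)
  let ι : T →+* K := T.val.toRingHom
  have hι : Function.Injective ι := Subtype.val_injective
  have mem : ∀ x ∈ s, x ∈ ι.range := fun x hx => ⟨⟨x, Algebra.subset_adjoin hx⟩, rfl⟩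
  obtain ⟨P', hP'⟩ := exists_lift ι P (fun J => by
    by_cases hJ : co P J = 0
    · rw [hJ]; exact zero_mem _
    · apply mem
      simp only [s, Finset.mem_union, Finset.mem_image]
      exact Or.inl (Or.inl ⟨J, by simpa using hJ, rfl⟩))
  obtain ⟨Q', hQ'⟩ := exists_lift ι Q (fun J => by
    by_cases hJ : co Q J = 0
    · rw [hJ]; exact zero_mem _
    · apply mem
      simp only [s, Finset.mem_union, Finset.mem_image]
      exact Or.inl (Or.inr ⟨J, by simpa using hJ, rfl⟩))
  obtain ⟨d, hd⟩ := mem (co Q I)⁻¹ (by simp [s])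
  have hrel : Q' * P' = P' * Q' + 1 := by
    apply wmap_inj hι
    rw [map_mul, map_add, map_mul, map_one, hP', hQ', h]
  have hst' : st Q' = -Q' := by
    apply wmap_inj hι
    rw [wmap_st, map_neg, hQ', hst]
  have hdu : d * co Q' I = 1 := by
    apply hι
    rw [map_mul, map_one, hd, ← co_wmap, hQ', inv_mul_cancel₀ hI]
  have bd : ∀ (w' : WA T) (w : WA K), wmap ι w' = w → (∀ J, co w J ≠ 0 → J.1 + J.2 ≤ N) →
      ∀ J, co (wmap (phi p) (wmap ψ w')) J ≠ 0 → J.1 + J.2 ≤ N := by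
    intro w' w hw hb J hJ
    apply hb
    intro h0
    apply hJ
    rw [← hw, co_wmap] at h0
    have : co w' J = 0 := hι (by rw [h0, map_zero])
    rw [co_wmap, co_wmap, this, map_zero, map_zero]
  refine modp (p := p) (P := wmap ψ P') (Q := wmap ψ Q') ?_ N (by omega) (by omega) (by omega)
    (bd P' P hP' fun J hJ => (hM J hJ).trans (by omega))
    (bd Q' Q hQ' fun J hJ => (hM' J hJ).trans (by omega)) ?_ I ?_
  · rw [← map_mul, hrel, map_add, map_mul, map_one]
  · rw [← wmap_st, hst', map_neg]
  · rw [co_wmap, co_wmap]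
    intro h0
    have := congrArg (fun t => phi p (ψ t)) hdu
    simp only [map_mul, h0, mul_zero, map_one] at this
    exact zero_ne_one this

theorem WA_ext {R : Type} [CommRing R] {B : Type} [Ring B] [Algebra R B] {F G : WA R →ₐ[R] B}
    (hx : F (wx R) = G (wx R)) (hy : F (wy R) = G (wy R)) (w : WA R) : F w = G w := by
  induction w using W_induction with
  | h0 r => simp
  | hx => exact hx
  | hy => exact hy
  | ha a b h1 h2 => rw [map_add, map_add, h1, h2]
  | hm a b h1 h2 => rw [map_mul, map_mul, h1, h2]

theorem exists_polyY {R : Type} [CommRing R] (h : WA R) (h0 : ∀ a b, co h (a+1, b) = 0) :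
    ∃ q : Polynomial R, h = Polynomial.aeval (wy R) q := by
  refine ⟨∑ I ∈ (co h).support, Polynomial.monomial I.2 (co h I), ?_⟩
  conv_lhs => rw [sum_mo h]
  rw [map_sum]
  refine Finset.sum_congr rfl fun I hI => ?_
  obtain ⟨a, b⟩ := I
  rw [Polynomial.aeval_monomial, ← Algebra.smul_def]
  cases a with
  | zero => simp [mo]
  | succ a => simp [h0 a b]

theorem core {K : Type} [Field K] [CharZero K] (G : WA K →ₐ[K] WA K)
    (hst : ∀ w, G (st w) = st (G w)) : Function.Bijective G := by
  have hrel : G (wy K) * G (wx K) = G (wx K) * G (wy K) + 1 := by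
    rw [← map_mul, W_rel, map_add, map_mul, map_one]
  have hstQ : st (G (wy K)) = - G (wy K) := by rw [← hst, st_y, map_neg]
  have hc0 := core0 hrel hstQ
  obtain ⟨c, d, hQ⟩ : ∃ c d : K, G (wy K) = c • wy K + d • 1 := by
    refine ⟨co (G (wy K)) (0,1), co (G (wy K)) (0,0), ?_⟩
    apply co_inj
    intro I
    have e1 : wy K = mo K (0,1) := by simp [mo]
    rw [map_add, map_smul, map_smul]
    rw [Finsupp.add_apply, Finsupp.smul_apply, Finsupp.smul_apply, co_one]
    conv_rhs => rw [e1, co_mo, ← e1]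
    rw [Finsupp.single_apply]
    by_cases hI : co (G (wy K)) I = 0
    · rw [hI]
      by_cases h1 : I = (0,0)
      · subst h1; simp [hI]
      · by_cases h2 : (0,1) = I
        · subst h2; simp [hI]
        · simp [h1, h2]
    · rcases hc0 I hI with rfl | rfl <;> simp
  have hd : d = 0 := by
    rw [hQ, st_add, st_smul, st_smul, st_y, st_one] at hstQ
    have h2 : (2 * d) • (1 : WA K) = 0 := by
      have : d • (1 : WA K) + d • (1 : WA K) = 0 := by
        have h3 := sub_eq_zero.mpr hstQ
        rw [← h3, smul_neg]; abel
      rw [two_mul, add_smul, this]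
    have := congrArg (fun w => co w (0,0)) h2
    simpa [co_one] using this
  rw [hd, zero_smul, add_zero] at hQ
  have hc : c ≠ 0 := by
    rintro rfl
    rw [zero_smul] at hQ
    rw [hQ, zero_mul, mul_zero, zero_add] at hrel
    have := congrArg (fun w => co w (0,0)) hrel
    simp [co_one] at this
  have hb : wy K * (G (wx K) - c⁻¹ • wx K) - (G (wx K) - c⁻¹ • wx K) * wy K = 0 := by
    have h1 : wy K * G (wx K) = G (wx K) * wy K + c⁻¹ • 1 := by
      have : c⁻¹ • (c • wy K * G (wx K)) = c⁻¹ • (G (wx K) * (c • wy K) + 1) := by rw [← hQ, hrel]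
      simpa [smul_smul, hc] using this
    rw [mul_sub, sub_mul, h1, mul_smul_comm, W_rel, smul_mul_assoc, smul_add]
    abel
  obtain ⟨q, hq⟩ := exists_polyY (G (wx K) - c⁻¹ • wx K) (fun a b => by
    have := co_bracket_y (G (wx K) - c⁻¹ • wx K) a b
    rw [hb] at this
    have h2 : (a + 1 : K) ≠ 0 := by exact_mod_cast Nat.succ_ne_zero a
    simpa [h2, -map_sub] using this.symm)
  have hP : G (wx K) = c⁻¹ • wx K + Polynomial.aeval (wy K) q := by rw [← hq]; abel
  set h' : WA K := Polynomial.aeval (c⁻¹ • wy K) q with hh'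
  have hcomm : wy K * h' = h' * wy K := by
    have h1 : Commute (c⁻¹ • wy K) h' := by
      have := congrArg (Polynomial.aeval (c⁻¹ • wy K)) (mul_comm Polynomial.X q)
      rw [map_mul, map_mul, Polynomial.aeval_X] at this
      exact this
    have h2 := h1.smul_left c
    rw [smul_smul, mul_inv_cancel₀ hc, one_smul] at h2
    exact h2
  let H : WA K →ₐ[K] WA K := wlift (c • (wx K - h')) (c⁻¹ • wy K) (by
    rw [smul_mul_smul_comm, smul_mul_smul_comm, mul_inv_cancel₀ hc, inv_mul_cancel₀ hc, one_smul, one_smul,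
      mul_sub, sub_mul, hcomm, W_rel]
    abel)
  have Hx : H (wx K) = c • (wx K - h') := wlift_x _ _ _
  have Hy : H (wy K) = c⁻¹ • wy K := wlift_y _ _ _
  have GH : ∀ w, G (H w) = w := by
    refine WA_ext (F := G.comp H) (G := AlgHom.id K _) ?_ ?_
    · show G (H (wx K)) = wx K
      rw [Hx, map_smul, map_sub, hh', ← Polynomial.aeval_algHom_apply, map_smul, hQ, hP, smul_smul,
        inv_mul_cancel₀ hc, one_smul, add_sub_cancel_right, smul_smul, mul_inv_cancel₀ hc, one_smul]
    · show G (H (wy K)) = wy K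
      rw [Hy, map_smul, hQ, smul_smul, inv_mul_cancel₀ hc, one_smul]
  have HG : ∀ w, H (G w) = w := by
    refine WA_ext (F := H.comp G) (G := AlgHom.id K _) ?_ ?_
    · show H (G (wx K)) = wx K
      rw [hP, map_add, map_smul, ← Polynomial.aeval_algHom_apply, Hx, Hy, smul_smul,
        inv_mul_cancel₀ hc, one_smul, sub_add_cancel]
    · show H (G (wy K)) = wy K
      rw [hQ, map_smul, Hy, smul_smul, mul_inv_cancel₀ hc, one_smul]
  exact Function.bijective_iff_has_inverse.mpr ⟨H, HG, GH⟩

section EAux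
variable {K : Type} [CommSemiring K] {A : Type} [Semiring A] [Algebra K A]

theorem ea_comp {f g : A → A} (hf : IsAlgEndo K f ∨ IsAntiEndo K f)
    (hg : IsAlgEndo K g ∨ IsAntiEndo K g) : IsAlgEndo K (f ∘ g) ∨ IsAntiEndo K (f ∘ g) := by
  rcases hf with ⟨a1, s1, m1, o1⟩ | ⟨a1, s1, m1, o1⟩ <;>
  rcases hg with ⟨a2, s2, m2, o2⟩ | ⟨a2, s2, m2, o2⟩
  · left; exact ⟨by simp [a1, a2], by simp [s1, s2], by simp [m1, m2], by simp [o1, o2]⟩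
  · right; exact ⟨by simp [a1, a2], by simp [s1, s2], by simp [m1, m2], by simp [o1, o2]⟩
  · right; exact ⟨by simp [a1, a2], by simp [s1, s2], by simp [m1, m2], by simp [o1, o2]⟩
  · left; exact ⟨by simp [a1, a2], by simp [s1, s2], by simp [m1, m2], by simp [o1, o2]⟩

theorem ea_inv {f h : A → A} (hf : IsAlgAuto K f ∨ IsAntiAuto K f) (hl : ∀ x, h (f x) = x)
    (hr : ∀ x, f (h x) = x) : IsAlgAuto K h ∨ IsAntiAuto K h := by
  have hb : Function.Bijective h := Function.bijective_iff_has_inverse.mpr ⟨f, hr, hl⟩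
  rcases hf with ⟨⟨a1, s1, m1, o1⟩, b1⟩ | ⟨⟨a1, s1, m1, o1⟩, b1⟩
  · left
    refine ⟨⟨fun a b => b1.1 ?_, fun a b => b1.1 ?_, fun a b => b1.1 ?_, b1.1 ?_⟩, hb⟩
    · simp [hr, a1]
    · simp [hr, s1]
    · simp [hr, m1]
    · simp [hr, o1]
  · right
    refine ⟨⟨fun a b => b1.1 ?_, fun a b => b1.1 ?_, fun a b => b1.1 ?_, b1.1 ?_⟩, hb⟩
    · simp [hr, a1]
    · simp [hr, s1]
    · simp [hr, m1]
    · simp [hr, o1]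

end EAux

section Glue
variable {K : Type} [Field K] [CharZero K]

def psi (K : Type) [Field K] [CharZero K] : WA K →ₐ[K] WA K :=
  wlift (wx K + wy K) ((2:K)⁻¹ • (wy K - wx K)) (by
    have h2 : (1 : WA K) = (2:K)⁻¹ • ((1 : WA K) + 1) := by
      rw [← two_smul K (1 : WA K), smul_smul, inv_mul_cancel₀ two_ne_zero, one_smul]
    have e : (wy K - wx K) * (wx K + wy K) = (wx K + wy K) * (wy K - wx K) + (1 + 1) := by
      simp only [mul_add, add_mul, sub_mul, mul_sub, W_rel]; abel
    rw [smul_mul_assoc, mul_smul_comm, e, smul_add, ← h2])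

def psi' (K : Type) [Field K] [CharZero K] : WA K →ₐ[K] WA K :=
  wlift ((2:K)⁻¹ • wx K - wy K) ((2:K)⁻¹ • wx K + wy K) (by
    have h2 : (1 : WA K) = (2:K)⁻¹ • (1 : WA K) + (2:K)⁻¹ • (1 : WA K) := by
      rw [← add_smul, ← two_mul, mul_inv_cancel₀ two_ne_zero, one_smul]
    conv_rhs => rw [h2]
    simp only [mul_add, add_mul, sub_mul, mul_sub, smul_mul_assoc, mul_smul_comm, W_rel, smul_add, smul_sub]
    abel)

theorem half_add (w : WA K) : (2:K)⁻¹ • w + (2:K)⁻¹ • w = w := by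
  rw [← add_smul, ← two_mul, mul_inv_cancel₀ two_ne_zero, one_smul]

theorem half_two (w : WA K) : (2:K)⁻¹ • (w + w) = w := by
  rw [smul_add, half_add]

theorem psi_psi' (w : WA K) : psi K (psi' K w) = w := by
  refine WA_ext (F := (psi K).comp (psi' K)) (G := AlgHom.id K _) ?_ ?_ w
  · show psi K (psi' K (wx K)) = wx K
    rw [psi', wlift_x, psi, map_sub, map_smul, wlift_x, wlift_y, ← smul_sub]
    refine Eq.trans ?_ (half_two (wx K))
    congr 1; abel
  · show psi K (psi' K (wy K)) = wy K
    rw [psi', wlift_y, psi, map_add, map_smul, wlift_x, wlift_y, ← smul_add]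
    refine Eq.trans ?_ (half_two (wy K))
    congr 1; abel

theorem psi'_psi (w : WA K) : psi' K (psi K w) = w := by
  refine WA_ext (F := (psi' K).comp (psi K)) (G := AlgHom.id K _) ?_ ?_ w
  · show psi' K (psi K (wx K)) = wx K
    rw [psi, wlift_x, psi', map_add, wlift_x, wlift_y]
    refine Eq.trans ?_ (half_add (wx K))
    abel
  · show psi' K (psi K (wy K)) = wy K
    rw [psi, wlift_y, psi', map_smul, map_sub, wlift_x, wlift_y]
    refine Eq.trans ?_ (half_two (wy K))
    congr 1; abel

theorem psi_st (α : WA K → WA K) (hα : IsAntiEndo K α) (hx : α (wx K) = wy K)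
    (hy : α (wy K) = wx K) (w : WA K) : α (psi K w) = psi K (st w) := by
  obtain ⟨a1, s1, m1, o1⟩ := hα
  have neg1 : ∀ a, α (-a) = - α a := fun a => by
    rw [← neg_one_smul K a, s1, neg_one_smul]
  induction w using W_induction with
  | h0 r => rw [st_algebraMap, AlgHom.commutes, Algebra.algebraMap_eq_smul_one, s1, o1]
  | hx => rw [st_x, psi, wlift_x, a1, hx, hy, add_comm]
  | hy =>
    rw [st_y, map_neg, psi, wlift_y, s1, sub_eq_add_neg, a1, neg1, hx, hy, ← smul_neg]
    congr 1; abel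
  | ha a b h1 h2 => rw [st_add, map_add, map_add, a1, h1, h2]
  | hm a b h1 h2 => rw [st_mul, map_mul, map_mul, m1, h1, h2]

def toAH (F : WA K → WA K) (hF : IsAlgEndo K F) : WA K →ₐ[K] WA K :=
  AlgHom.ofLinearMap ⟨⟨F, hF.1⟩, hF.2.1⟩ hF.2.2.2 hF.2.2.1

theorem main_endo (α F : WA K → WA K) (hα : IsAntiEndo K α) (hx : α (wx K) = wy K)
    (hy : α (wy K) = wx K) (hF : IsAlgEndo K F) (hc : ∀ w, F (α w) = α (F w)) :
    Function.Bijective F := by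
  let G : WA K →ₐ[K] WA K := (psi' K).comp ((toAH F hF).comp (psi K))
  have hG : ∀ w, G w = psi' K (F (psi K w)) := fun w => rfl
  have hGb : Function.Bijective G := by
    apply core
    intro w
    rw [hG, hG, ← psi_st α hα hx hy, hc]
    have h1 := psi_st α hα hx hy (psi' K (F (psi K w)))
    rw [psi_psi'] at h1
    rw [h1, psi'_psi]
  have hb : Function.Bijective (psi K) :=
    Function.bijective_iff_has_inverse.mpr ⟨psi' K, psi'_psi, psi_psi'⟩
  have hb' : Function.Bijective (psi' K) :=
    Function.bijective_iff_has_inverse.mpr ⟨psi K, psi_psi', psi'_psi⟩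
  have e : F = psi K ∘ G ∘ psi' K := by
    funext w
    simp only [Function.comp_apply, hG, psi_psi']
  rw [e]
  exact hb.comp (hGb.comp hb')

theorem main_ea (α F : WA K → WA K) (hα : IsAntiAuto K α) (hx : α (wx K) = wy K)
    (hy : α (wy K) = wx K) (hF : IsAlgEndo K F ∨ IsAntiEndo K F) (hc : ∀ w, F (α w) = α (F w)) :
    Function.Bijective F := by
  rcases hF with hF | hF
  · exact main_endo α F hα.1 hx hy hF hc
  · have h1 : IsAlgEndo K (α ∘ F) := by
      obtain ⟨a1, s1, m1, o1⟩ := hα.1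
      obtain ⟨a2, s2, m2, o2⟩ := hF
      exact ⟨by simp [a1, a2], by simp [s1, s2], by simp [m1, m2], by simp [o1, o2]⟩
    have h2 := main_endo α (α ∘ F) hα.1 hx hy h1 (fun w => by simp [hc])
    exact (hα.2.of_comp_iff' F).mp h2

theorem inv_left {A : Type} [Nonempty A] {g : A → A} (hg : Function.Bijective g) (x : A) :
    Function.invFun g (g x) = x := Function.leftInverse_invFun hg.1 x
theorem inv_right {A : Type} [Nonempty A] {g : A → A} (hg : Function.Bijective g) (x : A) :
    g (Function.invFun g x) = x := Function.rightInverse_invFun hg.2 x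

theorem final (α f : Weyl K → Weyl K) (hα : IsExchange K α) (hf : IsAlgEndo K f) :
    (∃ γ δ : Weyl K → Weyl K, IsInvolutionOn K γ ∧ ConjToAlpha K α γ ∧ IsInvolutionOn K δ ∧
      ConjToAlpha K α δ ∧ f ∘ γ = δ ∘ f) ↔ IsAlgAuto K f := by
  constructor
  · rintro ⟨γ, δ, -, ⟨g1, hg1, rfl⟩, -, ⟨g2, hg2, rfl⟩, h⟩
    refine ⟨hf, ?_⟩
    have b1 : Function.Bijective g1 := hg1.elim And.right And.right
    have b2 : Function.Bijective g2 := hg2.elim And.right And.right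
    have i1 := ea_inv hg1 (inv_left b1) (inv_right b1)
    have bi1 : Function.Bijective (Function.invFun g1) := i1.elim And.right And.right
    have hcm : ∀ w : Weyl K, g2 (f (Function.invFun g1 (α w))) = α (g2 (f (Function.invFun g1 w))) := by
      intro w
      have h1 := congrFun h (Function.invFun g1 w)
      simp only [Function.comp_apply] at h1
      rw [inv_right b1] at h1
      rw [h1, inv_right b2]
    have hF : Function.Bijective (g2 ∘ f ∘ Function.invFun g1) := by
      refine main_ea (K := K) α (g2 ∘ f ∘ Function.invFun g1) hα.1.1 hα.2.1 hα.2.2 ?_ ?_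
      · exact ea_comp (hg2.imp And.left And.left)
          (ea_comp (Or.inl hf) (i1.imp And.left And.left))
      · exact hcm
    have h3 := (b2.of_comp_iff' _).mp hF
    exact (Function.Bijective.of_comp_iff f bi1).mp h3
  · rintro ⟨-, hb⟩
    obtain ⟨h, hl, hr⟩ := Function.bijective_iff_has_inverse.mp hb
    have hh : IsAlgAuto K h := by
      refine ⟨⟨fun a b => hb.1 ?_, fun a b => hb.1 ?_, fun a b => hb.1 ?_, hb.1 ?_⟩,
        Function.bijective_iff_has_inverse.mpr ⟨f, hr, hl⟩⟩
      · rw [hf.1, hr, hr, hr]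
      · rw [hf.2.1, hr, hr]
      · rw [hf.2.2.1, hr, hr, hr]
      · rw [hr, hf.2.2.2]
    have hinv : Function.invFun h = f := by
      funext x
      apply hh.2.1
      rw [inv_right hh.2, hl]
    have hid : Function.invFun (id : Weyl K → Weyl K) = id := by
      funext x
      exact inv_right (g := id) Function.bijective_id x
    obtain ⟨⟨⟨⟨a1, s1, m1, o1⟩, b1⟩, i1⟩, hx, hy⟩ := id hα
    obtain ⟨a2, s2, m2, o2⟩ := hf
    obtain ⟨⟨a3, s3, m3, o3⟩, b3⟩ := hh
    refine ⟨α, f ∘ α ∘ h, hα.1, ⟨id, Or.inl ⟨⟨fun _ _ => rfl, fun _ _ => rfl, fun _ _ => rfl, rfl⟩,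
      Function.bijective_id⟩, by rw [hid]; rfl⟩, ⟨⟨⟨?_, ?_, ?_, ?_⟩, hb.comp (b1.comp b3)⟩, ?_⟩,
      ⟨h, Or.inl ⟨⟨a3, s3, m3, o3⟩, b3⟩, by rw [hinv]⟩, ?_⟩
    · intro a b; simp only [Function.comp_apply, a1, a2, a3]
    · intro a b; simp only [Function.comp_apply, s1, s2, s3]
    · intro a b; simp only [Function.comp_apply, m1, m2, m3]
    · simp only [Function.comp_apply, o1, o2, o3]
    · funext x
      have := congrFun i1 (h x)
      simp only [Function.comp_apply, id] at this
      simp only [Function.comp_apply, id, hl (α (h x)), this, hr x]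
    · funext x
      simp only [Function.comp_apply, hl x]

end Glue

/-- an endomorphism `f` of `A₁` intertwines two involutions, each conjugate to
the exchange involution `α`, if and only if `f` is an automorphism. -/
theorem stmt_2 {K : Type} [Field K] [CharZero K]
    (α f : Weyl K → Weyl K) (hα : IsExchange K α) (hf : IsAlgEndo K f) :
    (∃ γ δ : Weyl K → Weyl K,
      IsInvolutionOn K γ ∧ ConjToAlpha K α γ ∧
      IsInvolutionOn K δ ∧ ConjToAlpha K α δ ∧
      f ∘ γ = δ ∘ f) ↔ IsAlgAuto K f := by
  exact final α f hα hf
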